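/- arXiv:1905.10526 — 4 statements merged into one kernel-verified Lean document; each statement's English description precedes it below -/
import Mathlib

section
/- For all integers n ≥ 0 and k ≥ 2, and every integer b ≥ 0, the number of partitions of {0,1,…,n} with exactly b blocks whose colored arc diagram has no black enhanced k-crossing equals the number of partitions of {0,1,…,n} with exactly b blocks having no k-crossing. Equivalently, Σ_{P ∈ BNW_{n+1}^{(k)}} t^{|P|} = Σ_{P ∈ NC_{n+1}^{(k)}} t^{|P|} in ℤ[t], where |P| is the number of blocks of P. -/
open Finset Polynomial

/-- `(i,j)` with `i < j` is an arc of the arc diagram of `P`: `i` and `j` lie in a common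
block `B` and no element of `B` is strictly between them. -/
def IsArc {s : Finset ℕ} (P : Finpartition s) (i j : ℕ) : Prop :=
  i < j ∧ ∃ B ∈ P.parts, i ∈ B ∧ j ∈ B ∧ ∀ l ∈ B, ¬(i < l ∧ l < j)

/-- `(i,j)` is an arc or a loop (`i = j` and `{i}` a singleton block) of the arc diagram. -/
def IsDiagArc {s : Finset ℕ} (P : Finpartition s) (i j : ℕ) : Prop :=
  IsArc P i j ∨ (i = j ∧ {i} ∈ P.parts)

/-- `P` has a `k`-crossing: arcs `(i₁,j₁),…,(i_k,j_k)` with `i₁<⋯<i_k<j₁<⋯<j_k`. -/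
def HasKCrossing {s : Finset ℕ} (P : Finpartition s) (k : ℕ) : Prop :=
  ∃ f g : Fin k → ℕ,
    StrictMono f ∧ StrictMono g ∧ (∀ m, IsDiagArc P (f m) (g m)) ∧
    ∀ a b : Fin k, f a < g b

/-- `P` has a weak `k`-crossing: arcs `(i₁,j₁),…,(i_k,j_k)` with
`i₁<⋯<i_k = j₁<⋯<j_k` (the largest left endpoint equals the smallest right endpoint). -/
def HasWeakKCrossing {s : Finset ℕ} (P : Finpartition s) (k : ℕ) : Prop :=
  ∃ f g : Fin k → ℕ,
    StrictMono f ∧ StrictMono g ∧ (∀ m, IsDiagArc P (f m) (g m)) ∧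
    ∃ a b : Fin k, f a = g b ∧ (∀ c, f c ≤ f a) ∧ (∀ c, g b ≤ g c)

/-- `P` has an enhanced `k`-crossing: a `k`-crossing or a weak `k`-crossing. -/
def HasEnhancedKCrossing {s : Finset ℕ} (P : Finpartition s) (k : ℕ) : Prop :=
  HasKCrossing P k ∨ HasWeakKCrossing P k

open scoped Classical in
/-- The generating polynomial `∑ t^{number of blocks}` over the partitions of `s`
satisfying the predicate `pr`. -/
noncomputable def partPoly (s : Finset ℕ) (pr : Finpartition s → Prop) : Polynomial ℤ :=
  ∑ P : Finpartition s, if pr P then (X : Polynomial ℤ) ^ P.parts.card else 0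


/-- `i` is a red node of `P`: it lies in the block containing `0` (the red block). -/
def IsRed {s : Finset ℕ} (P : Finpartition s) (i : ℕ) : Prop :=
  ∃ B ∈ P.parts, 0 ∈ B ∧ i ∈ B

/-- `(i,j)` is a black arc: an arc of the diagram which is not between two red nodes. -/
def IsBlackArc {s : Finset ℕ} (P : Finpartition s) (i j : ℕ) : Prop :=
  IsDiagArc P i j ∧ ¬ (IsRed P i ∧ IsRed P j)

/-- `P` has a black `k`-crossing. -/
def HasBlackKCrossing {s : Finset ℕ} (P : Finpartition s) (k : ℕ) : Prop :=
  ∃ f g : Fin k → ℕ,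
    StrictMono f ∧ StrictMono g ∧ (∀ m, IsBlackArc P (f m) (g m)) ∧
    ∀ a b : Fin k, f a < g b

/-- `P` has a black weak `k`-crossing. -/
def HasBlackWeakKCrossing {s : Finset ℕ} (P : Finpartition s) (k : ℕ) : Prop :=
  ∃ f g : Fin k → ℕ,
    StrictMono f ∧ StrictMono g ∧ (∀ m, IsBlackArc P (f m) (g m)) ∧
    ∃ a b : Fin k, f a = g b ∧ (∀ c, f c ≤ f a) ∧ (∀ c, g b ≤ g c)

/-- `P` has a black enhanced `k`-crossing. -/
def HasBlackEnhancedKCrossing {s : Finset ℕ} (P : Finpartition s) (k : ℕ) : Prop :=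
  HasBlackKCrossing P k ∨ HasBlackWeakKCrossing P k

/-- `x` and `y` lie in a common block of `P`. -/
def SameBlock {s : Finset ℕ} (P : Finpartition s) (x y : ℕ) : Prop :=
  ∃ B ∈ P.parts, x ∈ B ∧ y ∈ B

namespace SameBlock

variable {s : Finset ℕ} {P : Finpartition s} {x y z : ℕ}

lemma symm (h : SameBlock P x y) : SameBlock P y x := by
  obtain ⟨B, hB, hx, hy⟩ := h
  exact ⟨B, hB, hy, hx⟩

lemma trans (h : SameBlock P x y) (h' : SameBlock P y z) : SameBlock P x z := by
  obtain ⟨B, hB, hx, hy⟩ := h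
  obtain ⟨C, hC, hy', hz⟩ := h'
  obtain rfl := P.eq_of_mem_parts hB hC hy hy'
  exact ⟨B, hB, hx, hz⟩

lemma mem_left (h : SameBlock P x y) : x ∈ s := by
  obtain ⟨B, hB, hx, -⟩ := h
  exact P.le hB hx

lemma mem_right (h : SameBlock P x y) : y ∈ s := h.symm.mem_left

lemma refl (h : x ∈ s) : SameBlock P x x := by
  obtain ⟨B, hB, hx⟩ := P.exists_mem h
  exact ⟨B, hB, hx, hx⟩

lemma mem_iff {B : Finset ℕ} (hB : B ∈ P.parts) (hx : x ∈ B) : y ∈ B ↔ SameBlock P x y := by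
  refine ⟨fun hy => ⟨B, hB, hx, hy⟩, ?_⟩
  rintro ⟨C, hC, hx', hy⟩
  rwa [P.eq_of_mem_parts hB hC hx hx']

end SameBlock

section Arcs

variable {s : Finset ℕ} {P Q : Finpartition s} {i j x y : ℕ}

lemma isArc_iff : IsArc P i j ↔
    i < j ∧ SameBlock P i j ∧ ∀ l, i < l → l < j → ¬ SameBlock P i l := by
  constructor
  · rintro ⟨hij, B, hB, hi, hj, h⟩
    exact ⟨hij, ⟨B, hB, hi, hj⟩, fun l h1 h2 hl => h l ((SameBlock.mem_iff hB hi).2 hl) ⟨h1, h2⟩⟩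
  · rintro ⟨hij, ⟨B, hB, hi, hj⟩, h⟩
    exact ⟨hij, B, hB, hi, hj, fun l hl hl' => h l hl'.1 hl'.2 ⟨B, hB, hi, hl⟩⟩

lemma IsArc.lt (h : IsArc P i j) : i < j := h.1

lemma IsArc.sameBlock (h : IsArc P i j) : SameBlock P i j := (isArc_iff.1 h).2.1

lemma IsArc.right_unique {j' : ℕ} (h : IsArc P i j) (h' : IsArc P i j') : j = j' := by
  rw [isArc_iff] at h h'
  rcases lt_trichotomy j j' with hlt | heq | hlt
  · exact absurd h.2.1 (h'.2.2 j h.1 hlt)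
  · exact heq
  · exact absurd h'.2.1 (h.2.2 j' h'.1 hlt)

lemma IsArc.left_unique {i' : ℕ} (h : IsArc P i j) (h' : IsArc P i' j) : i = i' := by
  rw [isArc_iff] at h h'
  have hS : SameBlock P i i' := h.2.1.trans h'.2.1.symm
  rcases lt_trichotomy i i' with hlt | heq | hlt
  · exact absurd hS (h.2.2 i' hlt h'.1)
  · exact heq
  · exact absurd hS.symm (h'.2.2 i hlt h.1)

lemma SameBlock.exists_isArc (h : SameBlock P x y) (hxy : x < y) :
    ∃ l, x ≤ l ∧ IsArc P l y := by
  obtain ⟨B, hB, hx, hy⟩ := h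
  have hne : (B.filter (· < y)).Nonempty := ⟨x, by simp [hx, hxy]⟩
  have hmem := (B.filter (· < y)).max'_mem hne
  simp only [mem_filter] at hmem
  refine ⟨_, Finset.le_max' _ x (by simp [hx, hxy]), hmem.2, B, hB, hmem.1, hy, ?_⟩
  intro l hl hl'
  exact absurd (Finset.le_max' (B.filter (· < y)) l (by simp [hl, hl'.2])) (not_le.2 hl'.1)

lemma SameBlock.reflTransGen (h : SameBlock P x y) (hxy : x ≤ y) :
    Relation.ReflTransGen (IsArc P) x y := by
  induction y using Nat.strong_induction_on with
  | _ y ih =>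
    rcases hxy.eq_or_lt with rfl | hlt
    · exact .refl
    · obtain ⟨l, hxl, hl⟩ := h.exists_isArc hlt
      exact (ih l hl.lt (h.trans hl.sameBlock.symm) hxl).tail hl

lemma SameBlock.of_reflTransGen (hx : x ∈ s) (h : Relation.ReflTransGen (IsArc P) x y) :
    SameBlock P x y := by
  induction h with
  | refl => exact .refl hx
  | tail _ h ih => exact ih.trans h.sameBlock

lemma sameBlock_of_isArc_imp (h : ∀ i j, IsArc P i j → IsArc Q i j) (hS : SameBlock P x y) :
    SameBlock Q x y := by
  rcases le_total x y with hxy | hxy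
  · exact .of_reflTransGen hS.mem_left (Relation.ReflTransGen.mono h _ _ (hS.reflTransGen hxy))
  · exact (SameBlock.of_reflTransGen hS.mem_right
      (Relation.ReflTransGen.mono h _ _ (hS.symm.reflTransGen hxy))).symm

lemma finpartition_eq_of_isArc_iff (h : ∀ i j, IsArc P i j ↔ IsArc Q i j) : P = Q := by
  have key : ∀ {P Q : Finpartition s}, (∀ i j, IsArc P i j ↔ IsArc Q i j) →
      P.parts ⊆ Q.parts := by
    intro P Q h B hB
    obtain ⟨x, hx⟩ := P.nonempty_of_mem_parts hB
    obtain ⟨C, hC, hx'⟩ := Q.exists_mem (P.le hB hx)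
    have : B = C := by
      ext y
      rw [SameBlock.mem_iff hB hx, SameBlock.mem_iff hC hx']
      exact ⟨sameBlock_of_isArc_imp fun i j => (h i j).1,
        sameBlock_of_isArc_imp fun i j => (h i j).2⟩
    rwa [this]
  exact Finpartition.ext (Subset.antisymm (key h) (key fun i j => (h i j).symm))

open scoped Classical in
lemma card_parts_eq (P : Finpartition s) :
    P.parts.card = (s.filter fun y => ∀ i, ¬ IsArc P i y).card := by
  symm
  refine Finset.card_nbij P.part ?_ ?_ ?_
  · intro y hy
    exact P.part_mem.2 (mem_filter.1 hy).1
  · intro y hy y' hy' h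
    obtain ⟨hy, hmin⟩ := mem_filter.1 hy
    obtain ⟨hy', hmin'⟩ := mem_filter.1 hy'
    have hS : SameBlock P y y' :=
      ⟨P.part y, P.part_mem.2 hy, P.mem_part hy, by
        have h : P.part y = P.part y' := h
        rw [h]; exact P.mem_part hy'⟩
    rcases lt_trichotomy y y' with hlt | heq | hlt
    · obtain ⟨l, -, hl⟩ := hS.exists_isArc hlt
      exact absurd hl (hmin' l)
    · exact heq
    · obtain ⟨l, -, hl⟩ := hS.symm.exists_isArc hlt
      exact absurd hl (hmin l)
  · intro B hB
    have hB : B ∈ P.parts := hB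
    have hne := P.nonempty_of_mem_parts hB
    have hm := B.min'_mem hne
    refine ⟨B.min' hne, mem_coe.2 (mem_filter.2 ⟨P.le hB hm, ?_⟩), P.part_eq_of_mem hB hm⟩
    intro i hi
    have := (SameBlock.mem_iff hB hm).2 hi.sameBlock.symm
    exact absurd (B.min'_le i this) (not_le.2 hi.lt)

end Arcs

section OfArcs

variable {A : ℕ → ℕ → Prop}

lemma le_of_reflTransGen_of_lt (hlt : ∀ i j, A i j → i < j) {x y : ℕ}
    (h : Relation.ReflTransGen A x y) : x ≤ y := by
  induction h with
  | refl => exact le_rfl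
  | tail _ h ih => exact ih.trans (hlt _ _ h).le

/-- The equivalence relation whose classes are the chains of arcs of `A`. -/
def chainSetoid (A : ℕ → ℕ → Prop) (hr : Relator.RightUnique A) (hl : Relator.LeftUnique A) :
    Setoid ℕ where
  r x y := Relation.ReflTransGen A x y ∨ Relation.ReflTransGen A y x
  iseqv :=
    { refl := fun _ => .inl .refl
      symm := fun h => h.symm
      trans := by
        rintro x y z (h | h) (h' | h')
        · exact .inl (h.trans h')
        · have hl' : Relator.RightUnique (Function.swap A) := fun a b c hab hac => hl hab hac
          have := Relation.ReflTransGen.total_of_right_unique hl'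
            (Relation.reflTransGen_swap.2 h) (Relation.reflTransGen_swap.2 h')
          simp only [Relation.reflTransGen_swap] at this
          exact this.symm
        · exact Relation.ReflTransGen.total_of_right_unique hr h h'
        · exact .inr (h'.trans h) }

open scoped Classical in
/-- The partition of `s` into chains of arcs of `A`. -/
noncomputable def chainPartition (s : Finset ℕ) (A : ℕ → ℕ → Prop)
    (hr : Relator.RightUnique A) (hl : Relator.LeftUnique A) : Finpartition s :=
  Finpartition.ofSetSetoid (chainSetoid A hr hl) s

lemma sameBlock_chainPartition {s : Finset ℕ} {hr : Relator.RightUnique A}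
    {hl : Relator.LeftUnique A} {x y : ℕ} (hx : x ∈ s) (hy : y ∈ s) :
    SameBlock (chainPartition s A hr hl) x y ↔
      Relation.ReflTransGen A x y ∨ Relation.ReflTransGen A y x := by
  classical
  have hmem := Finpartition.mem_part_ofSetSetoid_iff_rel (s := chainSetoid A hr hl) s
    (a := x) (b := y)
  rw [Finpartition.mem_part_iff_exists] at hmem
  exact ⟨fun h => (hmem.1 h.symm).2.2, fun h => SameBlock.symm (hmem.2 ⟨hx, hy, h⟩)⟩

lemma isArc_chainPartition {s : Finset ℕ} {hr : Relator.RightUnique A}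
    {hl : Relator.LeftUnique A} (hlt : ∀ i j, A i j → i < j)
    (hs : ∀ i j, A i j → i ∈ s ∧ j ∈ s) {i j : ℕ} :
    IsArc (chainPartition s A hr hl) i j ↔ A i j := by
  have key : ∀ x y, SameBlock (chainPartition s A hr hl) x y → x < y → ∃ m, A x m ∧ m ≤ y := by
    intro x y hS hxy
    rcases (sameBlock_chainPartition hS.mem_left hS.mem_right).1 hS with h | h
    · rcases h.cases_head with rfl | ⟨m, hm, h⟩
      · exact absurd hxy (lt_irrefl _)
      · exact ⟨m, hm, le_of_reflTransGen_of_lt hlt h⟩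
    · exact absurd hxy (not_lt.2 (le_of_reflTransGen_of_lt hlt h))
  have hS : ∀ x y, A x y → SameBlock (chainPartition s A hr hl) x y := fun x y h =>
    (sameBlock_chainPartition (hs x y h).1 (hs x y h).2).2 (.inl (.single h))
  rw [isArc_iff]
  constructor
  · rintro ⟨hij, hSij, hno⟩
    obtain ⟨m, hm, hmj⟩ := key i j hSij hij
    rcases hmj.eq_or_lt with rfl | hmj
    · exact hm
    · exact absurd (hS i m hm) (hno m (hlt _ _ hm) hmj)
  · intro h
    refine ⟨hlt _ _ h, hS _ _ h, fun l hil hlj hSl => ?_⟩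
    obtain ⟨m, hm, hml⟩ := key i l hSl hil
    have := hr h hm
    omega

end OfArcs

section Shift

variable {n : ℕ} {P Q : Finpartition (Finset.range (n + 1))} {i j : ℕ}

lemma isRed_zero (P : Finpartition (Finset.range (n + 1))) : IsRed P 0 :=
  SameBlock.refl (by simp)

lemma IsArc.isRed_iff (h : IsArc P i j) : IsRed P i ↔ IsRed P j :=
  ⟨fun hi => SameBlock.trans hi h.sameBlock, fun hj => SameBlock.trans hj h.sameBlock.symm⟩

/-- The arcs obtained from `P` by shifting the left endpoint of each black arc one step to the
left, and by joining each nonzero red element to its predecessor. -/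
def ShiftArc (P : Finpartition (Finset.range (n + 1))) (i j : ℕ) : Prop :=
  (i < j ∧ IsArc P (i + 1) j ∧ ¬ IsRed P j) ∨ (j = i + 1 ∧ IsRed P j)

lemma ShiftArc.lt (h : ShiftArc P i j) : i < j := by
  rcases h with h | h
  · exact h.1
  · omega

lemma ShiftArc.mem_range (h : ShiftArc P i j) :
    i ∈ Finset.range (n + 1) ∧ j ∈ Finset.range (n + 1) := by
  have hij := h.lt
  have hj : j ∈ Finset.range (n + 1) := by
    rcases h with h | h
    · exact h.2.1.sameBlock.mem_right
    · exact SameBlock.mem_right h.2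
  simp only [Finset.mem_range] at hj ⊢
  omega

lemma shiftArc_rightUnique (P : Finpartition (Finset.range (n + 1))) :
    Relator.RightUnique (ShiftArc P) := by
  rintro i j j' (⟨-, h, hb⟩ | ⟨rfl, h⟩) (⟨-, h', hb'⟩ | ⟨rfl, h'⟩)
  · exact h.right_unique h'
  · exact absurd (h.isRed_iff.1 h') hb
  · exact absurd (h'.isRed_iff.1 h) hb'
  · rfl

lemma shiftArc_leftUnique (P : Finpartition (Finset.range (n + 1))) :
    Relator.LeftUnique (ShiftArc P) := by
  rintro i i' j (⟨-, h, hb⟩ | ⟨h0, h⟩) (⟨-, h', hb'⟩ | ⟨h0', h'⟩)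
  · exact Nat.succ_injective (h.left_unique h')
  · exact absurd h' hb
  · exact absurd h hb'
  · omega

/-- The partition whose arcs are the shifted arcs of `P`. -/
noncomputable def shiftPartition (P : Finpartition (Finset.range (n + 1))) :
    Finpartition (Finset.range (n + 1)) :=
  chainPartition _ (ShiftArc P) (shiftArc_rightUnique P) (shiftArc_leftUnique P)

lemma isArc_shiftPartition : IsArc (shiftPartition P) i j ↔ ShiftArc P i j :=
  isArc_chainPartition (fun _ _ => ShiftArc.lt) (fun _ _ => ShiftArc.mem_range)

lemma isRed_iff_shiftArc : IsRed P j ↔ j = 0 ∨ ∃ i, j = i + 1 ∧ ShiftArc P i j := by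
  constructor
  · intro h
    rcases j with _ | i
    · exact .inl rfl
    · exact .inr ⟨i, rfl, .inr ⟨rfl, h⟩⟩
  · rintro (rfl | ⟨i, hj, ⟨-, h, -⟩ | h⟩)
    · exact isRed_zero P
    · exact absurd h.lt (by omega)
    · exact h.2

lemma isArc_iff_shiftArc : IsArc P i j ↔ (∃ l, i = l + 1 ∧ i < j ∧ ShiftArc P l j) ∨
    (i < j ∧ IsRed P i ∧ IsRed P j ∧ ∀ l, i < l → l < j → ¬ IsRed P l) := by
  constructor
  · intro h
    by_cases hj : IsRed P j
    · refine .inr ⟨h.lt, h.isRed_iff.2 hj, hj, fun l h1 h2 hl => ?_⟩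
      exact (isArc_iff.1 h).2.2 l h1 h2 ((SameBlock.symm (h.isRed_iff.2 hj)).trans hl)
    · rcases i with _ | l
      · exact absurd (h.isRed_iff.1 (isRed_zero P)) hj
      · exact .inl ⟨l, rfl, h.lt, .inl ⟨by have := h.lt; omega, h, hj⟩⟩
  · rintro (⟨l, rfl, hlt, ⟨-, h, -⟩ | ⟨h, -⟩⟩ | ⟨hlt, hi, hj, hno⟩)
    · exact h
    · omega
    · exact isArc_iff.2 ⟨hlt, (SameBlock.symm hi).trans hj,
        fun l h1 h2 hl => hno l h1 h2 (SameBlock.trans hi hl)⟩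

lemma shiftPartition_injective :
    Function.Injective (shiftPartition : Finpartition (Finset.range (n + 1)) → _) := by
  intro P Q h
  have hA : ∀ i j, ShiftArc P i j ↔ ShiftArc Q i j := fun i j => by
    rw [← isArc_shiftPartition, h, isArc_shiftPartition]
  have hR : ∀ j, IsRed P j ↔ IsRed Q j := fun j => by
    simp only [isRed_iff_shiftArc, hA]
  refine finpartition_eq_of_isArc_iff fun i j => ?_
  simp only [isArc_iff_shiftArc, hA, hR]

lemma exists_shiftArc_iff :
    (∃ i, ShiftArc P i j) ↔ ∃ i, IsArc P i j := by
  constructor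
  · rintro ⟨i, ⟨-, h, -⟩ | ⟨h0, h⟩⟩
    · exact ⟨_, h⟩
    · obtain ⟨l, -, hl⟩ := SameBlock.exists_isArc h (by omega)
      exact ⟨l, hl⟩
  · rintro ⟨i, h⟩
    have hlt := h.lt
    rcases isArc_iff_shiftArc.1 h with ⟨l, -, -, h⟩ | ⟨-, -, hj, -⟩
    · exact ⟨l, h⟩
    · exact ⟨j - 1, .inr ⟨by omega, hj⟩⟩

lemma card_parts_shiftPartition (P : Finpartition (Finset.range (n + 1))) :
    (shiftPartition P).parts.card = P.parts.card := by
  classical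
  rw [card_parts_eq, card_parts_eq]
  congr 1
  refine Finset.filter_congr fun y _ => ?_
  simp only [← not_exists, isArc_shiftPartition, exists_shiftArc_iff]

lemma hasKCrossing_iff {s : Finset ℕ} {P : Finpartition s} {k : ℕ} :
    HasKCrossing P k ↔ ∃ f g : Fin k → ℕ, StrictMono f ∧ StrictMono g ∧
      (∀ m, IsArc P (f m) (g m)) ∧ ∀ a b, f a < g b := by
  constructor
  · rintro ⟨f, g, hf, hg, harc, hlt⟩
    exact ⟨f, g, hf, hg, fun m => (harc m).resolve_right fun h => (hlt m m).ne h.1, hlt⟩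
  · rintro ⟨f, g, hf, hg, harc, hlt⟩
    exact ⟨f, g, hf, hg, fun m => .inl (harc m), hlt⟩

lemma not_diag_of_strictMono {k : ℕ} (hk : 2 ≤ k) {f g : Fin k → ℕ} (hf : StrictMono f)
    (hg : StrictMono g) (hle : ∀ a b, f a ≤ g b) (m : Fin k) : f m ≠ g m := by
  intro h
  have : Nontrivial (Fin k) := Fin.nontrivial_iff_two_le.2 hk
  obtain ⟨m', hm'⟩ := exists_ne m
  rcases lt_or_gt_of_ne hm' with hlt | hlt
  · exact absurd (hle m m') (not_le.2 (h ▸ hg hlt))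
  · exact absurd (hle m' m) (not_le.2 (h ▸ hf hlt))

lemma hasBlackEnhancedKCrossing_iff {k : ℕ} (hk : 2 ≤ k) :
    HasBlackEnhancedKCrossing P k ↔ ∃ f g : Fin k → ℕ, StrictMono f ∧ StrictMono g ∧
      (∀ m, IsArc P (f m) (g m) ∧ ¬ IsRed P (g m)) ∧ ∀ a b, f a ≤ g b := by
  have key : ∀ f g : Fin k → ℕ, StrictMono f → StrictMono g → (∀ a b, f a ≤ g b) →
      (∀ m, IsBlackArc P (f m) (g m)) → ∀ m, IsArc P (f m) (g m) ∧ ¬ IsRed P (g m) := by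
    intro f g hf hg hle hb m
    have h := (hb m).1.resolve_right fun h => not_diag_of_strictMono hk hf hg hle m h.1
    exact ⟨h, fun hr => (hb m).2 ⟨h.isRed_iff.2 hr, hr⟩⟩
  constructor
  · rintro (⟨f, g, hf, hg, harc, hlt⟩ | ⟨f, g, hf, hg, harc, a, b, hab, ha, hb⟩)
    · exact ⟨f, g, hf, hg, key f g hf hg (fun a b => (hlt a b).le) harc, fun a b => (hlt a b).le⟩
    · have hle : ∀ c d, f c ≤ g d := fun c d => ((ha c).trans hab.le).trans (hb d)
      exact ⟨f, g, hf, hg, key f g hf hg hle harc, hle⟩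
  · rintro ⟨f, g, hf, hg, harc, hle⟩
    have harc' : ∀ m, IsBlackArc P (f m) (g m) := fun m =>
      ⟨.inl (harc m).1, fun h => (harc m).2 h.2⟩
    by_cases h : ∃ a b, f a = g b
    · obtain ⟨a, b, hab⟩ := h
      exact .inr ⟨f, g, hf, hg, harc', a, b, hab, fun c => hab ▸ hle c b, fun c => hab ▸ hle a c⟩
    · push Not at h
      exact .inl ⟨f, g, hf, hg, harc', fun a b => lt_of_le_of_ne (hle a b) (h a b)⟩

lemma hasKCrossing_shiftPartition_iff {k : ℕ} (hk : 2 ≤ k) :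
    HasKCrossing (shiftPartition P) k ↔ HasBlackEnhancedKCrossing P k := by
  rw [hasKCrossing_iff, hasBlackEnhancedKCrossing_iff hk]
  simp only [isArc_shiftPartition]
  constructor
  · rintro ⟨f, g, hf, hg, harc, hlt⟩
    have hf' : StrictMono fun m => f m + 1 := fun a b hab => Nat.succ_lt_succ (hf hab)
    refine ⟨fun m => f m + 1, g, hf', hg, fun m => ?_, fun a b => hlt a b⟩
    rcases harc m with h | h
    · exact h.2
    · exact absurd h.1.symm (not_diag_of_strictMono hk hf' hg hlt m)
  · rintro ⟨f, g, hf, hg, harc, hle⟩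
    have hpos : ∀ m, 0 < f m := fun m => Nat.pos_of_ne_zero fun h0 =>
      (harc m).2 ((harc m).1.isRed_iff.1 (h0 ▸ isRed_zero P))
    refine ⟨fun m => f m - 1, g, fun a b hab => ?_, hg, fun m => .inl ⟨?_, ?_, (harc m).2⟩,
      fun a b => ?_⟩
    · have := hf hab
      have := hpos a
      show f a - 1 < f b - 1
      omega
    · have := (harc m).1.lt
      show f m - 1 < g m
      omega
    · rw [Nat.sub_add_cancel (hpos m)]
      exact (harc m).1
    · have := hle a b
      have := hpos a
      show f a - 1 < g b
      omega

end Shift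

/-- For all `n ≥ 0`, `k ≥ 2` and every `b ≥ 0`, the number of partitions
of `{0,1,…,n}` with exactly `b` blocks and no black enhanced `k`-crossing equals the
number of partitions of `{0,1,…,n}` with exactly `b` blocks and no `k`-crossing;
equivalently `∑_{P ∈ BNW_{n+1}^{(k)}} t^{|P|} = ∑_{P ∈ NC_{n+1}^{(k)}} t^{|P|}`. -/
theorem stmt10 (n k : ℕ) (hk : 2 ≤ k) (b : ℕ) :
    Nat.card {P : Finpartition (Finset.range (n + 1)) //
        ¬ HasBlackEnhancedKCrossing P k ∧ P.parts.card = b} =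
      Nat.card {P : Finpartition (Finset.range (n + 1)) //
        ¬ HasKCrossing P k ∧ P.parts.card = b} := by
  refine Nat.card_congr ((Equiv.ofBijective shiftPartition
    (Finite.injective_iff_bijective.1 shiftPartition_injective)).subtypeEquiv fun P => ?_)
  rw [Equiv.ofBijective_apply, hasKCrossing_shiftPartition_iff hk, card_parts_shiftPartition]
end

section
/- For all integers n ≥ 0 and k ≥ 2, the polynomial identity Σ_{P ∈ BNW_{n+1}^{(k)}} t^{|P|} = t · Σ_{i=0}^{n} C(n,i) · NW_i^{(k)}(t) holds in ℤ[t], where |P| is the number of blocks of P, NW_i^{(k)}(t) is the sum of t^{(number of blocks of Q)} over all enhanced k-noncrossing partitions Q of {1,…,i}, and NW_0^{(k)}(t) = 1. -/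
open Finset Polynomial

section Transport

variable {s t : Finset ℕ}

lemma IsDiagArc.left_mem {P : Finpartition s} {i j : ℕ} (h : IsDiagArc P i j) : i ∈ s := by
  rcases h with ⟨_, B, hB, hi, _⟩ | ⟨_, hi⟩
  · exact P.le hB hi
  · exact P.le hi (mem_singleton_self i)

lemma IsDiagArc.right_mem {P : Finpartition s} {i j : ℕ} (h : IsDiagArc P i j) : j ∈ s := by
  rcases h with ⟨_, B, hB, _, hj, _⟩ | ⟨rfl, hi⟩
  · exact P.le hB hj
  · exact P.le hi (mem_singleton_self i)

/-- Enhanced crossings are transported by an increasing map that preserves arcs and loops. -/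
lemma HasEnhancedKCrossing.of_strictMonoOn {P : Finpartition s} {Q : Finpartition t} {k : ℕ}
    {φ : ℕ → ℕ} (hφ : StrictMonoOn φ s)
    (harc : ∀ i j, IsDiagArc P i j → IsDiagArc Q (φ i) (φ j))
    (h : HasEnhancedKCrossing P k) : HasEnhancedKCrossing Q k := by
  rcases h with ⟨f, g, hf, hg, hfg, hlt⟩ | ⟨f, g, hf, hg, hfg, a, b, hab, ha, hb⟩
  · exact Or.inl ⟨φ ∘ f, φ ∘ g,
      fun c d hcd => hφ (hfg c).left_mem (hfg d).left_mem (hf hcd),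
      fun c d hcd => hφ (hfg c).right_mem (hfg d).right_mem (hg hcd),
      fun m => harc _ _ (hfg m),
      fun c d => hφ (hfg c).left_mem (hfg d).right_mem (hlt c d)⟩
  · exact Or.inr ⟨φ ∘ f, φ ∘ g,
      fun c d hcd => hφ (hfg c).left_mem (hfg d).left_mem (hf hcd),
      fun c d hcd => hφ (hfg c).right_mem (hfg d).right_mem (hg hcd),
      fun m => harc _ _ (hfg m), a, b, congrArg φ hab,
      fun c => hφ.monotoneOn (hfg c).left_mem (hfg a).left_mem (ha c),
      fun c => hφ.monotoneOn (hfg b).right_mem (hfg c).right_mem (hb c)⟩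

/-- The image of a partition under a map injective on its ground set. -/
def Finpartition.transport (P : Finpartition s) (φ : ℕ → ℕ) (hφ : Set.InjOn φ s)
    (hst : s.image φ = t) : Finpartition t where
  parts := P.parts.image (Finset.image φ)
  supIndep := by
    rw [Finset.supIndep_iff_pairwiseDisjoint]
    intro A hA B hB hAB
    simp only [coe_image, Set.mem_image, mem_coe] at hA hB
    obtain ⟨A, hA, rfl⟩ := hA
    obtain ⟨B, hB, rfl⟩ := hB
    have hd : Disjoint A B := P.disjoint hA hB (fun h => hAB (by rw [h]))
    simp only [Function.onFun, id, Finset.disjoint_left, mem_image] at hd ⊢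
    rintro _ ⟨x, hx, rfl⟩ ⟨y, hy, hxy⟩
    have := hφ (P.le hB hy) (P.le hA hx) hxy
    exact hd hx (this ▸ hy)
  sup_parts := by
    subst hst
    ext x
    simp only [mem_sup, mem_image, id]
    constructor
    · rintro ⟨_, ⟨B, hB, rfl⟩, hx⟩
      obtain ⟨y, hy, rfl⟩ := mem_image.1 hx
      exact ⟨y, P.le hB hy, rfl⟩
    · rintro ⟨y, hy, rfl⟩
      obtain ⟨B, hB, hyB⟩ := P.exists_mem hy
      exact ⟨_, ⟨B, hB, rfl⟩, mem_image_of_mem φ hyB⟩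
  bot_notMem := by
    simp only [mem_image, bot_eq_empty, image_eq_empty, not_exists, not_and]
    rintro B hB rfl
    exact P.bot_notMem hB

lemma Finpartition.transport_transport {P : Finpartition s} {φ ψ : ℕ → ℕ} (hφ : Set.InjOn φ s)
    (hst : s.image φ = t) (hψ : Set.InjOn ψ t) (hts : t.image ψ = s)
    (h : ∀ x ∈ s, ψ (φ x) = x) : (P.transport φ hφ hst).transport ψ hψ hts = P := by
  ext1
  have key : ∀ B ∈ P.parts, (B.image φ).image ψ = B := fun B hB => by
    rw [image_image]
    exact (image_congr fun x hx => h x (P.le hB hx)).trans image_id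
  change (P.parts.image (Finset.image φ)).image (Finset.image ψ) = P.parts
  rw [image_image]
  exact (image_congr key).trans image_id

lemma Finpartition.card_parts_transport (P : Finpartition s) {φ : ℕ → ℕ} (hφ : Set.InjOn φ s)
    (hst : s.image φ = t) : (P.transport φ hφ hst).parts.card = P.parts.card := by
  refine card_image_of_injOn fun A hA B hB hAB => ?_
  have hsub : ∀ A ∈ P.parts, ∀ B ∈ P.parts, A.image φ = B.image φ → A ⊆ B := by
    intro A hA B hB hAB x hx
    obtain ⟨y, hy, hyx⟩ := mem_image.1 (hAB ▸ mem_image_of_mem φ hx)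
    exact hφ (P.le hB hy) (P.le hA hx) hyx ▸ hy
  exact (hsub A hA B hB hAB).antisymm (hsub B hB A hA hAB.symm)

lemma IsDiagArc.transport {P : Finpartition s} {φ : ℕ → ℕ} (hφ : StrictMonoOn φ s)
    (hst : s.image φ = t) {i j : ℕ} (h : IsDiagArc P i j) :
    IsDiagArc (P.transport φ hφ.injOn hst) (φ i) (φ j) := by
  rcases h with ⟨hij, B, hB, hi, hj, hl⟩ | ⟨rfl, hi⟩
  · refine Or.inl ⟨hφ (P.le hB hi) (P.le hB hj) hij, B.image φ, mem_image_of_mem _ hB,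
      mem_image_of_mem φ hi, mem_image_of_mem φ hj, ?_⟩
    intro l hlB
    obtain ⟨x, hx, rfl⟩ := mem_image.1 hlB
    rw [hφ.lt_iff_lt (P.le hB hi) (P.le hB hx), hφ.lt_iff_lt (P.le hB hx) (P.le hB hj)]
    exact hl x hx
  · exact Or.inr ⟨rfl, mem_image.2 ⟨_, hi, image_singleton φ i⟩⟩

/-- Two finite sets of the same size are related by mutually inverse increasing maps. -/
lemma exists_strictMonoOn_image_eq (h : s.card = t.card) :
    ∃ φ ψ : ℕ → ℕ, StrictMonoOn φ s ∧ StrictMonoOn ψ t ∧ s.image φ = t ∧ t.image ψ = s ∧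
      (∀ x ∈ s, ψ (φ x) = x) ∧ ∀ x ∈ t, φ (ψ x) = x := by
  let e : s ≃o t := (s.orderIsoOfFin h).symm.trans (t.orderIsoOfFin rfl)
  let φ : ℕ → ℕ := fun x => if hx : x ∈ s then e ⟨x, hx⟩ else 0
  let ψ : ℕ → ℕ := fun x => if hx : x ∈ t then e.symm ⟨x, hx⟩ else 0
  have hφ : ∀ x (hx : x ∈ s), φ x = e ⟨x, hx⟩ := fun x hx => dif_pos hx
  have hψ : ∀ x (hx : x ∈ t), ψ x = e.symm ⟨x, hx⟩ := fun x hx => dif_pos hx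
  have hφt : ∀ x ∈ s, φ x ∈ t := fun x hx => hφ x hx ▸ (e ⟨x, hx⟩).2
  have hψs : ∀ x ∈ t, ψ x ∈ s := fun x hx => hψ x hx ▸ (e.symm ⟨x, hx⟩).2
  have hψφ : ∀ x ∈ s, ψ (φ x) = x := fun x hx => by
    rw [hψ _ (hφt x hx)]; simp [hφ x hx]
  have hφψ : ∀ x ∈ t, φ (ψ x) = x := fun x hx => by
    rw [hφ _ (hψs x hx)]; simp [hψ x hx]
  refine ⟨φ, ψ, fun x hx y hy hxy => ?_, fun x hx y hy hxy => ?_, ?_, ?_, hψφ, hφψ⟩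
  · rw [hφ x hx, hφ y hy]
    exact e.strictMono (show (⟨x, hx⟩ : s) < ⟨y, hy⟩ from hxy)
  · rw [hψ x hx, hψ y hy]
    exact e.symm.strictMono (show (⟨x, hx⟩ : t) < ⟨y, hy⟩ from hxy)
  · exact (image_subset_iff.2 hφt).antisymm
      fun x hx => mem_image.2 ⟨ψ x, hψs x hx, hφψ x hx⟩
  · exact (image_subset_iff.2 hψs).antisymm
      fun x hx => mem_image.2 ⟨φ x, hφt x hx, hψφ x hx⟩

/-- The generating polynomial of enhanced `k`-noncrossing partitions depends only on the size
of the ground set. -/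
lemma partPoly_noncrossing_congr (k : ℕ) (h : s.card = t.card) :
    partPoly s (fun P => ¬ HasEnhancedKCrossing P k) =
      partPoly t (fun P => ¬ HasEnhancedKCrossing P k) := by
  classical
  obtain ⟨φ, ψ, hφ, hψ, hst, hts, hψφ, hφψ⟩ := exists_strictMonoOn_image_eq h
  unfold partPoly
  refine sum_bij' (fun P _ => P.transport φ hφ.injOn hst) (fun Q _ => Q.transport ψ hψ.injOn hts)
    (fun _ _ => mem_univ _) (fun _ _ => mem_univ _)
    (fun P _ => Finpartition.transport_transport _ _ _ _ hψφ)
    (fun Q _ => Finpartition.transport_transport _ _ _ _ hφψ) fun P _ => ?_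
  have hiff : HasEnhancedKCrossing P k ↔
      HasEnhancedKCrossing (P.transport φ hφ.injOn hst) k := by
    refine ⟨fun hP => hP.of_strictMonoOn hφ fun i j hij => hij.transport hφ hst, fun hP => ?_⟩
    have := hP.of_strictMonoOn hψ fun i j hij => hij.transport hψ hts
    rwa [Finpartition.transport_transport _ _ _ _ hψφ] at this
  simp only [hiff, Finpartition.card_parts_transport]

end Transport

section RedBlock

variable {s t : Finset ℕ}

/-- If the blocks of `P` are those of `Q` together with a block containing `0`, then the black
arcs of `P` are the arcs and loops of `Q`. -/
lemma isBlackArc_iff_of_parts_eq_insert {P : Finpartition s} {Q : Finpartition t}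
    {R : Finset ℕ} (hR : 0 ∈ R) (hRQ : R ∉ Q.parts) (hP : P.parts = insert R Q.parts) (i j : ℕ) :
    IsBlackArc P i j ↔ IsDiagArc Q i j := by
  have hRP : R ∈ P.parts := hP ▸ mem_insert_self _ _
  have hQP : ∀ B ∈ Q.parts, B ∈ P.parts := fun B hB => hP ▸ mem_insert_of_mem hB
  have hred : ∀ x, IsRed P x ↔ x ∈ R := fun x =>
    ⟨fun ⟨B, hB, h0, hx⟩ => P.eq_of_mem_parts hB hRP h0 hR ▸ hx, fun hx => ⟨R, hRP, hR, hx⟩⟩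
  have hblack : ∀ B ∈ Q.parts, ∀ x ∈ B, x ∉ R := fun B hB x hx hxR =>
    hRQ (P.eq_of_mem_parts (hQP B hB) hRP hx hxR ▸ hB)
  simp only [IsBlackArc, hred]
  constructor
  · rintro ⟨⟨hij, B, hB, hi, hj, hl⟩ | ⟨rfl, hi⟩, hn⟩
    · rcases mem_insert.1 (hP ▸ hB) with rfl | hB
      · exact absurd ⟨hi, hj⟩ hn
      · exact Or.inl ⟨hij, B, hB, hi, hj, hl⟩
    · rcases mem_insert.1 (hP ▸ hi) with h | hi
      · have hiR : i ∈ R := h ▸ mem_singleton_self i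
        exact absurd ⟨hiR, hiR⟩ hn
      · exact Or.inr ⟨rfl, hi⟩
  · rintro (⟨hij, B, hB, hi, hj, hl⟩ | ⟨rfl, hi⟩)
    · exact ⟨Or.inl ⟨hij, B, hQP B hB, hi, hj, hl⟩, fun h => hblack B hB i hi h.1⟩
    · exact ⟨Or.inr ⟨rfl, hQP _ hi⟩, fun h => hblack _ hi i (mem_singleton_self i) h.1⟩

lemma hasBlackEnhancedKCrossing_iff_of_isBlackArc_iff {P : Finpartition s} {Q : Finpartition t}
    (h : ∀ i j, IsBlackArc P i j ↔ IsDiagArc Q i j) (k : ℕ) :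
    HasBlackEnhancedKCrossing P k ↔ HasEnhancedKCrossing Q k := by
  simp only [HasBlackEnhancedKCrossing, HasEnhancedKCrossing, HasBlackKCrossing, HasKCrossing,
    HasBlackWeakKCrossing, HasWeakKCrossing, h]

lemma zero_mem_range_succ_sdiff {n : ℕ} (ht : t ⊆ Icc 1 n) : 0 ∈ range (n + 1) \ t :=
  mem_sdiff.2 ⟨by simp, fun h => by simpa using ht h⟩

/-- The partition of `{0,…,n}` whose non-red blocks are the blocks of `Q`. -/
def Finpartition.addRed {n : ℕ} (Q : Finpartition t) (ht : t ⊆ Icc 1 n) :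
    Finpartition (range (n + 1)) :=
  Q.extend (b := range (n + 1) \ t)
    (ne_empty_of_mem (zero_mem_range_succ_sdiff ht)) disjoint_sdiff
    (union_sdiff_of_subset (ht.trans fun x hx => by simp at hx ⊢; omega))

lemma Finpartition.addRed_parts {n : ℕ} (Q : Finpartition t) (ht : t ⊆ Icc 1 n) :
    (Q.addRed ht).parts = insert (range (n + 1) \ t) Q.parts := rfl

lemma Finpartition.sdiff_notMem_parts {n : ℕ} (Q : Finpartition t) (ht : t ⊆ Icc 1 n) :
    range (n + 1) \ t ∉ Q.parts := fun h =>
  (mem_sdiff.1 (zero_mem_range_succ_sdiff ht)).2 (Q.le h (zero_mem_range_succ_sdiff ht))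

lemma Finpartition.addRed_injective {n : ℕ} {Q : Finpartition s} {Q' : Finpartition t}
    (hs : s ⊆ Icc 1 n) (ht : t ⊆ Icc 1 n) (h : Q.addRed hs = Q'.addRed ht) :
    (⟨s, Q⟩ : Σ s : Finset ℕ, Finpartition s) = ⟨t, Q'⟩ := by
  have hparts : insert (range (n + 1) \ s) Q.parts = insert (range (n + 1) \ t) Q'.parts :=
    congrArg Finpartition.parts h
  have hR : range (n + 1) \ s = range (n + 1) \ t :=
    (Q.addRed hs).eq_of_mem_parts (by rw [addRed_parts]; exact mem_insert_self _ _)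
      (by rw [h, addRed_parts]; exact mem_insert_self _ _)
      (zero_mem_range_succ_sdiff hs) (zero_mem_range_succ_sdiff ht)
  have hsub : Icc 1 n ⊆ range (n + 1) := fun x hx => by simp at hx ⊢; omega
  have hst : s = t := by
    rw [← Finset.sdiff_sdiff_eq_self (hs.trans hsub), hR, Finset.sdiff_sdiff_eq_self (ht.trans hsub)]
  subst hst
  have : Q = Q' := by
    ext1
    rw [← erase_insert (Q.sdiff_notMem_parts hs), hparts,
      erase_insert (Q'.sdiff_notMem_parts hs)]
  rw [this]

lemma Finpartition.exists_addRed_eq {n : ℕ} (P : Finpartition (range (n + 1))) :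
    ∃ (t : Finset ℕ) (ht : t ⊆ Icc 1 n) (Q : Finpartition t), Q.addRed ht = P := by
  obtain ⟨R, hR, h0⟩ := P.exists_mem (show 0 ∈ range (n + 1) by simp)
  have hdisj : ∀ B ∈ P.parts, B ≠ R → Disjoint B R := fun B hB hne => P.disjoint hB hR hne
  have ht : range (n + 1) \ R ⊆ Icc 1 n := by
    intro x hx
    rw [mem_sdiff, mem_range] at hx
    have : x ≠ 0 := fun h => hx.2 (h ▸ h0)
    rw [mem_Icc]; omega
  refine ⟨range (n + 1) \ R, ht,
    { parts := P.parts.erase R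
      supIndep := P.supIndep.subset (erase_subset _ _)
      sup_parts := ?_
      bot_notMem := fun h => P.bot_notMem (mem_of_mem_erase h) }, ?_⟩
  · ext x
    simp only [mem_sup, mem_erase, id, mem_sdiff]
    constructor
    · rintro ⟨B, ⟨hne, hB⟩, hx⟩
      exact ⟨P.le hB hx, Finset.disjoint_left.1 (hdisj B hB hne) hx⟩
    · rintro ⟨hx, hxR⟩
      obtain ⟨B, hB, hxB⟩ := P.exists_mem hx
      exact ⟨B, ⟨fun h => hxR (h ▸ hxB), hB⟩, hxB⟩
  · ext1
    rw [addRed_parts, Finset.sdiff_sdiff_eq_self (P.le hR)]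
    exact insert_erase hR

/-- Removing the red block. -/
lemma partPoly_black_eq_sum_powerset (n k : ℕ) :
    partPoly (range (n + 1)) (fun P => ¬ HasBlackEnhancedKCrossing P k) =
      X * ∑ t ∈ (Icc 1 n).powerset, partPoly t (fun P => ¬ HasEnhancedKCrossing P k) := by
  classical
  unfold partPoly
  rw [sum_sigma', mul_sum]
  symm
  refine sum_bij (fun a ha => a.2.addRed (mem_powerset.1 (mem_sigma.1 ha).1))
    (fun _ _ => mem_univ _) (fun _ _ _ _ h => Finpartition.addRed_injective _ _ h)
    (fun P _ => ?_) fun ⟨t, Q⟩ ha => ?_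
  · obtain ⟨t, ht, Q, hQ⟩ := P.exists_addRed_eq
    exact ⟨⟨t, Q⟩, mem_sigma.2 ⟨mem_powerset.2 ht, mem_univ _⟩, hQ⟩
  · have ht : t ⊆ Icc 1 n := mem_powerset.1 (mem_sigma.1 ha).1
    have hiff := hasBlackEnhancedKCrossing_iff_of_isBlackArc_iff
      (isBlackArc_iff_of_parts_eq_insert (zero_mem_range_succ_sdiff ht)
        (Q.sdiff_notMem_parts ht) (Q.addRed_parts ht)) k
    simp only [hiff, Finpartition.addRed_parts, card_insert_of_notMem (Q.sdiff_notMem_parts ht),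
      mul_ite, mul_zero, pow_succ']

end RedBlock

/-- For all `n ≥ 0`, `k ≥ 2`, in `ℤ[t]`:
`∑_{P ∈ BNW_{n+1}^{(k)}} t^{|P|} = t ⬝ ∑_{i=0}^n C(n,i) NW_i^{(k)}(t)`, where
`BNW_{n+1}^{(k)}` is the set of partitions of `{0,1,…,n}` with no black enhanced
`k`-crossing and `NW_i^{(k)}(t)` sums `t^{#blocks}` over enhanced `k`-noncrossing
partitions of `{1,…,i}` (`NW_0^{(k)}(t) = 1`). -/
theorem stmt11 (n k : ℕ) (hk : 2 ≤ k) :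
    partPoly (Finset.range (n + 1)) (fun P => ¬ HasBlackEnhancedKCrossing P k) =
      X * ∑ i ∈ Finset.range (n + 1),
        (C (n.choose i : ℤ)) *
          partPoly (Finset.Icc 1 i) (fun P => ¬ HasEnhancedKCrossing P k) := by
  rw [partPoly_black_eq_sum_powerset]
  congr 1
  rw [sum_congr rfl fun t _ => partPoly_noncrossing_congr (t := Icc 1 t.card) k (by simp),
    sum_powerset_apply_card (fun i => partPoly (Icc 1 i) (fun P => ¬ HasEnhancedKCrossing P k))]
  simp [nsmul_eq_mul]
end

section
/- Let k ≥ 2 and let P̃ be a partition of {0,1,…,n} whose colored arc diagram has no black k-crossing and has no red node under a black (k−1)-crossing. Let (i,j) be the rightmost red arc that belongs to some k-crossing of the arc diagram of P̃, and let (i_1,j_1),(i_2,j_2),…,(i_k,j_k) be the k-crossing with (i_p,j_p) = (i,j) for some p with 2 ≤ p ≤ k that is greatest in the lexicographic order of (j_1,j_2,…,j_k). Then the set of arcs obtained from the arc diagram of P̃ by replacing the arcs (i_1,j_1),…,(i_p,j_p) with the arcs (i_1,j_2),(i_2,j_3),…,(i_{p−1},j_p),(i_p,j_1), where the new arc (i_p,j_1)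 is colored red and the arcs (i_1,j_2),…,(i_{p−1},j_p) are colored black (all other arcs keeping their colors), contains no set of k black arcs forming a k-crossing. -/
open Finset Polynomial

/-- The set of black arcs of the colored arc diagram of `P`. -/
def BlackArcSet {s : Finset ℕ} (P : Finpartition s) : Set (ℕ × ℕ) :=
  {p | IsBlackArc P p.1 p.2}

/-- A set `A` of arcs contains `k` arcs forming a `k`-crossing:
arcs `(i₁,j₁),…,(i_k,j_k) ∈ A` with `i₁<⋯<i_k<j₁<⋯<j_k`. -/
def SetHasKCrossing (A : Set (ℕ × ℕ)) (k : ℕ) : Prop :=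
  ∃ f : Fin k → ℕ × ℕ, (∀ m, f m ∈ A) ∧ StrictMono (fun m => (f m).1) ∧
    StrictMono (fun m => (f m).2) ∧ ∀ a b : Fin k, (f a).1 < (f b).2

/-- Strict lexicographic order on words `Fin m → ℕ`. -/
def LexLt {m : ℕ} (u v : Fin m → ℕ) : Prop :=
  ∃ i : Fin m, (∀ j : Fin m, j < i → u j = v j) ∧ u i < v i

/-- The set of all arcs (and loops) of the arc diagram of `P`. -/
def ArcSet {s : Finset ℕ} (P : Finpartition s) : Set (ℕ × ℕ) :=
  {p | IsDiagArc P p.1 p.2}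

/-- `(i,j)` is a red arc: an arc of the diagram between two red nodes. -/
def IsRedArc {s : Finset ℕ} (P : Finpartition s) (i j : ℕ) : Prop :=
  IsDiagArc P i j ∧ IsRed P i ∧ IsRed P j

/-- The arc `q` belongs to some `k`-crossing of the arc diagram of `P`. -/
def InSomeKCrossing {s : Finset ℕ} (P : Finpartition s) (k : ℕ) (q : ℕ × ℕ) : Prop :=
  ∃ f : Fin k → ℕ × ℕ, (∀ m, f m ∈ ArcSet P) ∧ StrictMono (fun m => (f m).1) ∧
    StrictMono (fun m => (f m).2) ∧ (∀ a b : Fin k, (f a).1 < (f b).2) ∧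
    ∃ m, f m = q

/-- The first `k` terms of `F`, in this order, form a `k`-crossing. -/
def IsCrossingSeq (k : ℕ) (F : ℕ → ℕ × ℕ) : Prop :=
  (∀ a b, a < b → b < k → (F a).1 < (F b).1 ∧ (F a).2 < (F b).2) ∧
    ∀ a b, a < k → b < k → (F a).1 < (F b).2

/-- `F` with the terms at positions in `[v, w)` replaced by the terms of `E` from position `x`. -/
def splice (F E : ℕ → ℕ × ℕ) (v w x : ℕ) (a : ℕ) : ℕ × ℕ :=
  if v ≤ a ∧ a < w then E (a - v + x) else F a

lemma splice_of_mem {F E : ℕ → ℕ × ℕ} {v w x a : ℕ} (h : v ≤ a ∧ a < w) :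
    splice F E v w x a = E (a - v + x) := if_pos h

lemma splice_of_notMem {F E : ℕ → ℕ × ℕ} {v w x a : ℕ} (h : ¬ (v ≤ a ∧ a < w)) :
    splice F E v w x a = F a := if_neg h

lemma IsCrossingSeq.le {k : ℕ} {F : ℕ → ℕ × ℕ} (hF : IsCrossingSeq k F) {a b : ℕ}
    (hab : a ≤ b) (hb : b < k) : (F a).1 ≤ (F b).1 ∧ (F a).2 ≤ (F b).2 := by
  rcases hab.eq_or_lt with rfl | h
  · exact ⟨le_rfl, le_rfl⟩
  · exact ⟨(hF.1 a b h hb).1.le, (hF.1 a b h hb).2.le⟩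

lemma IsCrossingSeq.splice {k : ℕ} {F E : ℕ → ℕ × ℕ} (hF : IsCrossingSeq k F)
    (hE : IsCrossingSeq k E) {v w x y : ℕ} (hvw : v < w) (hy : y + 1 = x + (w - v)) (hyk : y < k)
    (hleft : 0 < v → (F (v - 1)).1 < (E x).1 ∧ (F (v - 1)).2 < (E x).2)
    (hright : w < k → (E y).1 < (F w).1 ∧ (E y).2 < (F w).2)
    (hFE : ∀ a < k, (F a).1 < (E x).2) (hEF : ∀ a < k, (E y).1 < (F a).2) :
    IsCrossingSeq k (splice F E v w x) := by
  have hmem : ∀ a, v ≤ a ∧ a < w → ((E x).1 ≤ (E (a - v + x)).1 ∧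
      (E x).2 ≤ (E (a - v + x)).2) ∧ ((E (a - v + x)).1 ≤ (E y).1 ∧
      (E (a - v + x)).2 ≤ (E y).2) := fun a ha =>
    ⟨hE.le (by omega) (by omega), hE.le (by omega) (by omega)⟩
  constructor
  · intro a b hab hb
    by_cases ha' : v ≤ a ∧ a < w <;> by_cases hb' : v ≤ b ∧ b < w
    · rw [splice_of_mem ha', splice_of_mem hb']
      exact hE.1 _ _ (by omega) (by omega)
    · rw [splice_of_mem ha', splice_of_notMem hb']
      have h1 := hright (by omega)
      have h2 := hF.le (a := w) (b := b) (by omega) hb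
      have h3 := hmem a ha'
      omega
    · rw [splice_of_notMem ha', splice_of_mem hb']
      have h1 := hleft (by omega)
      have h2 := hF.le (a := a) (b := v - 1) (by omega) (by omega)
      have h3 := hmem b hb'
      omega
    · rw [splice_of_notMem ha', splice_of_notMem hb']
      exact hF.1 a b hab hb
  · intro a b ha hb
    by_cases ha' : v ≤ a ∧ a < w <;> by_cases hb' : v ≤ b ∧ b < w
    · rw [splice_of_mem ha', splice_of_mem hb']
      exact hE.2 _ _ (by omega) (by omega)
    · rw [splice_of_mem ha', splice_of_notMem hb']
      exact (hmem a ha').2.1.trans_lt (hEF b hb)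
    · rw [splice_of_notMem ha', splice_of_mem hb']
      exact (hFE a ha).trans_le (hmem b hb').1.2
    · rw [splice_of_notMem ha', splice_of_notMem hb']
      exact hF.2 a b ha hb

lemma exists_threshold (Q : ℕ → Prop) (t : ℕ) :
    ∃ v ≤ t, (∀ a < v, Q a) ∧ (v < t → ¬ Q v) := by
  induction t with
  | zero => exact ⟨0, le_rfl, by simp, by simp⟩
  | succ t ih =>
    obtain ⟨v, hv, h1, h2⟩ := ih
    by_cases hQ : v = t ∧ Q t
    · refine ⟨t + 1, le_rfl, fun a ha => ?_, by omega⟩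
      obtain ⟨rfl, hQ⟩ := hQ
      rcases Nat.lt_succ_iff_lt_or_eq.1 ha with h | rfl
      · exact h1 a h
      · exact hQ
    · refine ⟨v, by omega, h1, fun _ hQv => ?_⟩
      by_cases hvt : v = t
      · subst hvt
        exact hQ ⟨rfl, hQv⟩
      · exact h2 (by omega) hQv

/-- `G` is a `k`-crossing of arcs in `A` whose only arc outside `B` is the one at position
`p ≥ 1`; it is lexicographically greatest among the `k`-crossings in `A` having `G p` at a
positive position, and `B` contains no `k`-crossing. -/
structure IsGreatestCrossing (A B : Set (ℕ × ℕ)) (k p : ℕ) (G : ℕ → ℕ × ℕ) : Prop where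
  one_le : 1 ≤ p
  lt : p < k
  crossing : IsCrossingSeq k G
  subset : B ⊆ A
  mem_arc : ∀ a < k, G a ∈ A
  mem_black : ∀ a < k, a ≠ p → G a ∈ B
  eq_of_fst_eq : ∀ x ∈ A, ∀ y ∈ A, x.1 < x.2 → y.1 < y.2 → x.1 = y.1 → x = y
  eq_of_snd_eq : ∀ x ∈ A, ∀ y ∈ A, x.1 < x.2 → y.1 < y.2 → x.2 = y.2 → x = y
  no_black : ∀ F, IsCrossingSeq k F → ¬ ∀ a < k, F a ∈ B
  greatest : ∀ F, IsCrossingSeq k F → (∀ a < k, F a ∈ A) → (∃ q, 1 ≤ q ∧ q < k ∧ F q = G p) →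
    ¬ ∃ c < k, (∀ a < c, (F a).2 = (G a).2) ∧ (G c).2 < (F c).2

namespace IsGreatestCrossing

variable {A B : Set (ℕ × ℕ)} {k p : ℕ} {G D : ℕ → ℕ × ℕ}

/-- An arc of `B` that is not among `G 0, …, G p`. -/
def IsOld (B : Set (ℕ × ℕ)) (p : ℕ) (G : ℕ → ℕ × ℕ) (x : ℕ × ℕ) : Prop :=
  x ∈ B ∧ ∀ m ≤ p, x ≠ G m

/-- The arc obtained by joining the left end of `G m` with the right end of `G (m + 1)`. -/
def IsNew (p : ℕ) (G : ℕ → ℕ × ℕ) (x : ℕ × ℕ) (m : ℕ) : Prop :=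
  m + 1 ≤ p ∧ x = ((G m).1, (G (m + 1)).2)

lemma IsNew.index_lt {m m' a b : ℕ} (h : IsGreatestCrossing A B k p G) (hD : IsCrossingSeq k D)
    (ha : IsNew p G (D a) m) (hb : IsNew p G (D b) m') (hab : a < b) (hbk : b < k) : m < m' := by
  by_contra! hle
  have h1 := (hD.1 a b hab hbk).1
  have h2 := (h.crossing.le hle (by have := ha.1; have := h.lt; omega)).1
  rw [ha.2, hb.2] at h1
  simp only at h1
  omega

lemma IsOld.ne (h : IsGreatestCrossing A B k p G) {x : ℕ × ℕ} (hx : IsOld B p G x)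
    (hlt : x.1 < x.2) {m : ℕ} (hm : m ≤ p) : x.1 ≠ (G m).1 ∧ x.2 ≠ (G m).2 := by
  have hmk : m < k := hm.trans_lt h.lt
  have hG := h.crossing.2 m m hmk hmk
  exact ⟨fun he => hx.2 m hm (h.eq_of_fst_eq x (h.subset hx.1) _ (h.mem_arc m hmk) hlt hG he),
    fun he => hx.2 m hm (h.eq_of_snd_eq x (h.subset hx.1) _ (h.mem_arc m hmk) hlt hG he)⟩

/-- Old arcs of another crossing cannot replace a run of at most as many terms of `G` in such a
way that the first right end increases. -/
lemma lt_of_splice_right (h : IsGreatestCrossing A B k p G) (hD : IsCrossingSeq k D)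
    {u w x y : ℕ} (huw : u < w) (hwk : w ≤ k) (hyk : y ≤ k)
    (hold : ∀ a, x ≤ a → a < y → IsOld B p G (D a))
    (hleft : x < y → 0 < u → (G (u - 1)).1 < (D x).1) (hgt : x < y → (G u).2 < (D x).2)
    (hright : x < y → w < k → (D (y - 1)).1 < (G w).1 ∧ (D (y - 1)).2 < (G w).2)
    (hend : x < y → w = k → (D (y - 1)).1 < (G 0).2) : y < x + (w - u) := by
  by_contra! hle
  have hxy : x < y := by omega
  specialize hleft hxy
  specialize hgt hxy
  specialize hright hxy
  specialize hend hxy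
  have hG := h.crossing
  have hz := hD.le (a := x + (w - u) - 1) (b := y - 1) (by omega) (by omega)
  have hDG : (D (x + (w - u) - 1)).1 < (G 0).2 := by
    rcases hwk.eq_or_lt with e | hw
    · have := hend e
      omega
    · have := hright hw
      have := hG.2 w 0 hw (by omega)
      omega
  have hS : IsCrossingSeq k (splice G D u w x) := by
    refine hG.splice hD (y := x + (w - u) - 1) huw (by omega) (by omega) ?_ ?_ ?_ ?_
    · intro hu
      exact ⟨hleft hu, ((hG.1 (u - 1) u (by omega) (by omega)).2).trans hgt⟩
    · intro hw
      have := hright hw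
      omega
    · intro a ha
      exact (hG.2 a u ha (by omega)).trans hgt
    · intro a ha
      exact hDG.trans_le (hG.le (Nat.zero_le a) ha).2
  have hin : ∀ a, u ≤ a ∧ a < w → splice G D u w x a ∈ B := fun a ha => by
    rw [splice_of_mem ha]
    exact (hold _ (by omega) (by omega)).1
  by_cases hp : u ≤ p ∧ p < w
  · refine h.no_black _ hS fun a ha => ?_
    by_cases ha' : u ≤ a ∧ a < w
    · exact hin a ha'
    · rw [splice_of_notMem ha']
      exact h.mem_black a ha fun e => ha' (e ▸ hp)
  · refine h.greatest _ hS (fun a ha => ?_) ⟨p, h.one_le, h.lt, splice_of_notMem hp⟩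
      ⟨u, by omega, fun a ha => by rw [splice_of_notMem (by omega)], ?_⟩
    · by_cases ha' : u ≤ a ∧ a < w
      · exact h.subset (hin a ha')
      · rw [splice_of_notMem ha']
        exact h.mem_arc a ha
    · rw [splice_of_mem ⟨le_rfl, huw⟩]
      simpa using hgt

/-- Terms of `G` cannot replace a run of another crossing containing all its arcs outside `B`,
provided that right ends become large enough whenever `G p` is used. -/
lemma not_splice_left (h : IsGreatestCrossing A B k p G) (hD : IsCrossingSeq k D)
    {v w x y : ℕ} (hvw : v < w) (hwk : w ≤ k) (hy : y + 1 = x + (w - v)) (hyk : y < k)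
    (hblack : ∀ a < k, ¬ (v ≤ a ∧ a < w) → D a ∈ B)
    (hleft : 0 < v → (D (v - 1)).1 < (G x).1 ∧ (D (v - 1)).2 < (G x).2)
    (hright : w < k → (G y).1 < (D w).1 ∧ (G y).2 < (D w).2)
    (hDG : ∀ a < k, (D a).1 < (G x).2) (hGD : ∀ a < k, (G y).1 < (D a).2)
    (hp : p ≤ y → (G 0).2 < (D 0).2 ∧ 0 < x ∧ (v = 0 → x ≠ p)) : False := by
  have hS := hD.splice h.crossing hvw hy hyk hleft hright hDG hGD
  by_cases hpx : x ≤ p ∧ p ≤ y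
  · obtain ⟨h0, hx, hv⟩ := hp hpx.2
    refine h.greatest _ hS (fun a ha => ?_) ⟨v + (p - x), by omega, by omega, ?_⟩
      ⟨0, by omega, by simp, ?_⟩
    · by_cases hmem : v ≤ a ∧ a < w
      · rw [splice_of_mem hmem]
        exact h.mem_arc _ (by omega)
      · rw [splice_of_notMem hmem]
        exact h.subset (hblack a ha hmem)
    · rw [splice_of_mem (by omega)]
      congr 1
      omega
    · by_cases hv0 : v = 0
      · rw [splice_of_mem (by omega)]
        exact (h.crossing.1 0 _ (by omega) (by omega)).2
      · rw [splice_of_notMem (by omega)]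
        exact h0
  · refine h.no_black _ hS fun a ha => ?_
    by_cases hmem : v ≤ a ∧ a < w
    · rw [splice_of_mem hmem]
      exact h.mem_black _ (by omega) (by omega)
    · rw [splice_of_notMem hmem]
      exact hblack a ha hmem

/-- Positions of new arcs grow at most as fast as their indices. -/
lemma add_index_le (h : IsGreatestCrossing A B k p G) (hD : IsCrossingSeq k D)
    (hcases : ∀ a < k, IsOld B p G (D a) ∨ ∃ m, IsNew p G (D a) m) {t L : ℕ}
    (ht : IsNew p G (D t) L) :
    ∀ d b m, b = t + d → b < k → IsNew p G (D b) m → d + L ≤ m := by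
  intro d
  induction d using Nat.strong_induction_on with
  | _ d ih =>
    intro b m hb hbk hm
    have hpk := h.lt
    rcases Nat.eq_zero_or_pos d with rfl | hd
    · by_contra! hlt
      have h1 := (h.crossing.1 m L (by omega) (by have := ht.1; omega)).1
      obtain rfl : b = t := by omega
      have h2 := congrArg Prod.fst (hm.2.symm.trans ht.2)
      simp only at h2
      omega
    · obtain ⟨c, hcd, hc1, hc2⟩ := exists_threshold
        (fun c => IsOld B p G (D (t + d - 1 - c))) (d - 1)
      have hlast : ∃ m', IsNew p G (D (t + d - 1 - c)) m' := by
        rcases hcd.eq_or_lt with e | hlt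
        · rw [show t + d - 1 - c = t by omega]
          exact ⟨L, ht⟩
        · exact (hcases _ (by omega)).resolve_left (hc2 hlt)
      obtain ⟨m', hm'⟩ := hlast
      set a := t + d - 1 - c with ha
      have hmm := hm'.index_lt h hD hm (by omega) hbk
      have hia := ih (a - t) (by omega) a m' (by omega) (by omega) hm'
      have hlt := h.lt_of_splice_right hD (u := m' + 1) (w := m + 1) (x := a + 1) (y := b)
        (by omega) (by have := hm.1; omega) hbk.le
        (fun e he he' => by
          have := hc1 (t + d - 1 - e) (by omega)
          rwa [show t + d - 1 - (t + d - 1 - e) = e by omega] at this)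
        (fun hx _ => by
          have := (hD.1 a (a + 1) (by omega) (by omega)).1
          rw [hm'.2] at this
          simpa using this)
        (fun hx => by
          have := (hD.1 a (a + 1) (by omega) (by omega)).2
          rw [hm'.2] at this
          simpa using this)
        (fun hx _ => by
          have h1 := hD.1 (b - 1) b (by omega) (by omega)
          have h2 := h.crossing.1 m (m + 1) (by omega) (by have := hm.1; omega)
          rw [hm.2] at h1
          simp only at h1
          omega)
        (fun _ e => by have := hm.1; omega)
      omega

/-- If the first right end of `D` is smaller than that of `G`, an initial run of `D` can be
continued by sufficiently many terms of `G` up to `G L`. -/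
lemma exists_head (h : IsGreatestCrossing A B k p G) (hD : IsCrossingSeq k D) {t L : ℕ}
    (htk : t < k) (hold : ∀ a < t, IsOld B p G (D a)) (ht : IsNew p G (D t) L)
    (h0 : (D 0).2 < (G 0).2) :
    ∃ v q, 0 < v ∧ v ≤ t ∧ q ≤ L ∧ t + q ≤ v + L ∧
      (D (v - 1)).1 < (G q).1 ∧ (D (v - 1)).2 < (G q).2 := by
  have hpk := h.lt
  have hL := ht.1
  have hDt1 : (D t).1 = (G L).1 := by rw [ht.2]
  have hDt2 : (D t).2 = (G (L + 1)).2 := by rw [ht.2]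
  have hpos : 0 < t := by
    rcases Nat.eq_zero_or_pos t with rfl | h'
    · have := (h.crossing.1 0 (L + 1) (by omega) (by omega)).2
      omega
    · exact h'
  by_contra hno
  have key : ∀ q ≤ L, ∃ v, 0 < v ∧ v ≤ t ∧ (G q).1 < (D (v - 1)).1 ∧
      (D (v - 1)).2 < (G q).2 := by
    intro q
    induction q with
    | zero =>
      intro _
      obtain ⟨v, hvt, hv1, hv2⟩ := exists_threshold (fun a => (D a).2 < (G 0).2) t
      have hv0 : 0 < v := by
        by_contra hv
        obtain rfl : v = 0 := by omega
        exact hv2 hpos h0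
      have hlt := h.lt_of_splice_right hD (u := 0) (w := L + 1) (x := v) (y := t)
        (by omega) (by omega) htk.le (fun a _ ha => hold a ha) (by omega)
        (fun hx => by
          have h1 := ((hold v hx).ne h (hD.2 v v (by omega) (by omega)) (Nat.zero_le p)).2
          have h2 := hv2 hx
          omega)
        (fun hx _ => by
          have h1 := hD.1 (t - 1) t (by omega) (by omega)
          have h2 := h.crossing.1 L (L + 1) (by omega) (by omega)
          omega)
        (by omega)
      refine ⟨v, hv0, hvt, ?_, hv1 (v - 1) (by omega)⟩
      by_contra hle
      have h1 := ((hold (v - 1) (by omega)).ne h (hD.2 _ _ (by omega) (by omega))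
        (Nat.zero_le p)).1
      exact hno ⟨v, 0, hv0, hvt, by omega, by omega, by omega, hv1 (v - 1) (by omega)⟩
    | succ q ih =>
      intro hq
      obtain ⟨v₀, hv₀, hv₀t, h₀1, h₀2⟩ := ih (by omega)
      obtain ⟨v, hvt, hv1, hv2⟩ := exists_threshold (fun a => (D a).2 < (G (q + 1)).2) t
      have hGq := h.crossing.1 q (q + 1) (by omega) (by omega)
      have hvv : v₀ ≤ v := by
        by_contra hv
        have h1 := hv2 (by omega)
        have h2 := hD.le (a := v) (b := v₀ - 1) (by omega) (by omega)
        omega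
      have hlt := h.lt_of_splice_right hD (u := q + 1) (w := L + 1) (x := v) (y := t)
        (by omega) (by omega) htk.le (fun a _ ha => hold a ha)
        (fun hx _ => by
          have h1 := hD.1 (v₀ - 1) v (by omega) (by omega)
          simp only [Nat.add_sub_cancel]
          omega)
        (fun hx => by
          have h1 := ((hold v hx).ne h (hD.2 v v (by omega) (by omega))
            (show q + 1 ≤ p by omega)).2
          have h2 := hv2 hx
          omega)
        (fun hx _ => by
          have h1 := hD.1 (t - 1) t (by omega) (by omega)
          have h2 := h.crossing.1 L (L + 1) (by omega) (by omega)
          omega)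
        (by omega)
      refine ⟨v, by omega, hvt, ?_, hv1 (v - 1) (by omega)⟩
      by_contra hle
      have h1 := ((hold (v - 1) (by omega)).ne h (hD.2 _ _ (by omega) (by omega))
        (show q + 1 ≤ p by omega)).1
      exact hno ⟨v, q + 1, by omega, hvt, by omega, by omega, by omega, hv1 (v - 1) (by omega)⟩
  obtain ⟨v, hv0, hvt, h1, -⟩ := key L le_rfl
  have h2 := hD.1 (v - 1) t (by omega) htk
  omega

/-- If many old arcs of `D` after position `s` start no later than `G q`, the last of them ends
after `G (q + 1)`. -/
lemma snd_lt_of_tail_long (h : IsGreatestCrossing A B k p G) (hD : IsCrossingSeq k D)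
    {s M v q : ℕ} (hold : ∀ a, s < a → a < k → IsOld B p G (D a))
    (hDs1 : (D s).1 = (G M).1) (hDs2 : (D s).2 = (G (M + 1)).2) (hsv : s < v) (hvk : v ≤ k)
    (hMq : M < q) (hqk : q < k) (hlarge : s + q < v + M) (hv : (D (v - 1)).1 ≤ (G q).1) :
    ∃ v, s + 1 < v ∧ v ≤ k ∧ q + 1 < k ∧
      (D (v - 1)).1 ≤ (G q).1 ∧ (G (q + 1)).2 < (D (v - 1)).2 := by
  by_contra hno
  have hq1 : q + 1 < k → (D (v - 1)).2 < (G (q + 1)).2 := fun hq => by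
    by_contra hle
    have hGq := (h.crossing.1 q (q + 1) (by omega) hq).1
    have hne : (D (v - 1)).2 ≠ (G (q + 1)).2 := fun e => by
      have := h.eq_of_snd_eq _ (h.subset (hold (v - 1) (by omega) (by omega)).1) _
        (h.mem_arc _ hq) (hD.2 _ _ (by omega) (by omega)) (h.crossing.2 _ _ hq hq) e
      rw [this] at hv
      omega
    exact hno ⟨v, by omega, hvk, hq, hv, by omega⟩
  have hlt := h.lt_of_splice_right hD (u := M + 1) (w := q + 1) (x := s + 1) (y := v)
    (by omega) (by omega) hvk (fun a ha ha' => hold a (by omega) (by omega))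
    (fun hx _ => by
      have := (hD.1 s (s + 1) (by omega) (by omega)).1
      simp only [Nat.add_sub_cancel]
      omega)
    (fun hx => by
      have := (hD.1 s (s + 1) (by omega) (by omega)).2
      omega)
    (fun _ hq => by
      have := h.crossing.1 q (q + 1) (by omega) hq
      exact ⟨by omega, hq1 hq⟩)
    (fun _ _ => by
      have := h.crossing.2 q 0 hqk (by omega)
      omega)
  omega

/-- A final run of `D` after its last new arc can be preceded by sufficiently many terms of `G`
from `G (M + 1)` on. -/
lemma exists_tail (h : IsGreatestCrossing A B k p G) (hD : IsCrossingSeq k D) {s M : ℕ}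
    (hsk : s < k) (hold : ∀ a, s < a → a < k → IsOld B p G (D a)) (hs : IsNew p G (D s) M) :
    ∃ v q, s < v ∧ v ≤ k ∧ M < q ∧ q < k ∧ v + M ≤ s + q ∧
      (v < k → (G q).1 < (D v).1 ∧ (G q).2 < (D v).2) := by
  have hpk := h.lt
  have hM := hs.1
  have hDs1 : (D s).1 = (G M).1 := by rw [hs.2]
  have hDs2 : (D s).2 = (G (M + 1)).2 := by rw [hs.2]
  by_contra hno
  have key : ∀ d q, q = M + 1 + d → q < k → ∃ v, s + 1 < v ∧ v ≤ k ∧ q + 1 < k ∧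
      (D (v - 1)).1 ≤ (G q).1 ∧ (G (q + 1)).2 < (D (v - 1)).2 := by
    intro d
    induction d with
    | zero =>
      intro q hq hqk
      obtain ⟨v, hvk, hv1, hv2⟩ := exists_threshold (fun a => (D a).1 ≤ (G q).1) k
      have hGM := h.crossing.1 M q (by omega) hqk
      have hsv : s < v := by
        by_contra hv
        have h1 := hv2 (by omega)
        have h2 := hD.le (a := v) (b := s) (by omega) hsk
        omega
      have hend : v < k → (G q).1 < (D v).1 ∧ (G q).2 < (D v).2 := fun hv => by
        have h1 := hD.1 s v hsv hv
        have h2 := hv2 hv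
        rw [hq, Nat.add_zero] at h2 ⊢
        omega
      have hlarge : s + q < v + M := by
        by_contra hle
        exact hno ⟨v, q, hsv, hvk, by omega, hqk, by omega, hend⟩
      exact h.snd_lt_of_tail_long hD hold hDs1 hDs2 hsv hvk (by omega) hqk hlarge (hv1 (v - 1) (by omega))
    | succ d ih =>
      intro q hq hqk
      obtain ⟨v₀, hv₀, hv₀k, -, h₀1, h₀2⟩ := ih (q - 1) (by omega) (by omega)
      rw [show q - 1 + 1 = q by omega] at h₀2
      obtain ⟨v, hvk, hv1, hv2⟩ := exists_threshold (fun a => (D a).1 ≤ (G q).1) k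
      have hGq := h.crossing.1 (q - 1) q (by omega) hqk
      have hvv : v₀ ≤ v := by
        by_contra hv
        have h1 := hv2 (by omega)
        have h2 := hD.le (a := v) (b := v₀ - 1) (by omega) (by omega)
        omega
      have hend : v < k → (G q).1 < (D v).1 ∧ (G q).2 < (D v).2 := fun hv => by
        have h1 := hD.1 (v₀ - 1) v (by omega) hv
        have h2 := hv2 hv
        omega
      have hlarge : s + q < v + M := by
        by_contra hle
        exact hno ⟨v, q, by omega, hvk, by omega, hqk, by omega, hend⟩
      exact h.snd_lt_of_tail_long hD hold hDs1 hDs2 (by omega) hvk (by omega) hqk hlarge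
        (hv1 (v - 1) (by omega))
  obtain ⟨v, -, -, hq, -⟩ := key (k - 1 - (M + 1)) (k - 1) (by omega) (by omega)
  omega

/-- No `k`-crossing consists of old and new arcs, unless all its arcs but the first pass over the
right end of `G p`. -/
theorem not_crossing_of_rotation (h : IsGreatestCrossing A B k p G) (hD : IsCrossingSeq k D)
    (hcases : ∀ a < k, IsOld B p G (D a) ∨ ∃ m, IsNew p G (D a) m)
    (hover : ¬ ∀ a, 1 ≤ a → a < k → D a ∈ B ∧ (D a).1 < (G p).2 ∧ (G p).2 < (D a).2) :
    False := by
  have hpk := h.lt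
  obtain ⟨t, htk, hoht, hnt⟩ := exists_threshold (fun a => IsOld B p G (D a)) k
  have htk' : t < k := by
    by_contra hle
    exact h.no_black D hD fun a ha => (hoht a (by omega)).1
  obtain ⟨L, hL⟩ := (hcases t htk').resolve_left (hnt htk')
  obtain ⟨c, hck, hohc, hnc⟩ := exists_threshold (fun c => IsOld B p G (D (k - 1 - c))) k
  have hck' : c < k := by
    by_contra hle
    have := hohc (k - 1 - t) (by omega)
    rw [show k - 1 - (k - 1 - t) = t by omega] at this
    exact hnt htk' this
  obtain ⟨M, hM⟩ := (hcases _ (by omega)).resolve_left (hnc hck')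
  obtain ⟨s, hs⟩ : ∃ s, s = k - 1 - c := ⟨_, rfl⟩
  rw [← hs] at hM
  have hohs : ∀ a, s < a → a < k → IsOld B p G (D a) := fun a ha hak => by
    have := hohc (k - 1 - a) (by omega)
    rwa [show k - 1 - (k - 1 - a) = a by omega] at this
  have hts : t ≤ s := by
    by_contra hlt
    exact hnc hck' (hs ▸ hoht s (by omega))
  have hgap := h.add_index_le hD hcases hL (s - t) s M (by omega) (by omega) hM
  have hLp := hL.1
  have hMp := hM.1
  have hDt1 : (D t).1 = (G L).1 := by rw [hL.2]
  have hDt2 : (D t).2 = (G (L + 1)).2 := by rw [hL.2]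
  have hDs1 : (D s).1 = (G M).1 := by rw [hM.2]
  have hDs2 : (D s).2 = (G (M + 1)).2 := by rw [hM.2]
  have hG0 : (G 0).2 < (D 0).2 := by
    by_contra hle
    have hne : (D 0).2 ≠ (G 0).2 := by
      rcases Nat.eq_zero_or_pos t with rfl | ht
      · have := (h.crossing.1 0 (L + 1) (by omega) (by omega)).2
        omega
      · exact ((hoht 0 ht).ne h (hD.2 0 0 (by omega) (by omega)) (Nat.zero_le p)).2
    obtain ⟨v, q, hv0, hvt, hqL, hcount, h1, h2⟩ :=
      h.exists_head hD htk' hoht hL (by omega)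
    have hq := h.crossing.le (a := q) (b := M + v - s) (by omega) (by omega)
    refine h.not_splice_left hD (v := v) (w := s + 1) (x := M + v - s) (y := M)
      (by omega) (by omega) (by omega) (by omega) (fun a ha hav => ?_) (fun _ => by omega)
      (fun hw => ?_) (fun a ha => ?_) (fun a ha => ?_) (by omega)
    · by_cases hav' : a < v
      · exact (hoht a (by omega)).1
      · exact (hohs a (by omega) ha).1
    · have := hD.1 s (s + 1) (by omega) hw
      have := h.crossing.1 M (M + 1) (by omega) (by omega)
      omega
    · have := hD.2 a (v - 1) ha (by omega)
      omega
    · have := hD.2 s a (by omega) ha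
      omega
  obtain ⟨v, q, hsv, hvk, hMq, hqk, hcount, hend⟩ := h.exists_tail hD (by omega) hohs hM
  by_cases hfirst : t = 0 ∧ L + 1 = p
  · obtain ⟨rfl, rfl⟩ := hfirst
    refine hover fun a ha hak => ⟨(hohs a (by omega) hak).1, ?_, ?_⟩
    · rw [← hDt2]
      exact hD.2 a 0 hak (by omega)
    · rw [← hDt2]
      exact (hD.1 0 a ha hak).2
  have hLM : L ≤ M := by omega
  have hy := h.crossing.le (a := L + (v - t)) (b := q) (by omega) hqk
  refine h.not_splice_left hD (v := t) (w := v) (x := L + 1) (y := L + (v - t))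
    (by omega) hvk (by omega) (by omega) (fun a ha hav => ?_) (fun ht => ?_)
    (fun hw => ?_) (fun a ha => ?_) (fun a ha => ?_) (fun _ => ⟨hG0, by omega, by omega⟩)
  · by_cases hav' : a < t
    · exact (hoht a hav').1
    · exact (hohs a (by omega) ha).1
  · have := hD.1 (t - 1) t (by omega) htk'
    have := h.crossing.1 L (L + 1) (by omega) (by omega)
    omega
  · have := hend hw
    omega
  · have := hD.2 a t ha htk'
    omega
  · have := h.crossing.2 (L + (v - t)) 0 (by omega) (by omega)
    have := hD.le (Nat.zero_le a) ha
    omega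

end IsGreatestCrossing

section Arcs

variable {s : Finset ℕ} {P : Finpartition s}

lemma IsDiagArc.isArc {a b : ℕ} (h : IsDiagArc P a b) (hab : a < b) : IsArc P a b :=
  h.resolve_right fun h' => hab.ne h'.1

lemma IsArc.right_unique_s14 {a b c : ℕ} (hb : IsArc P a b) (hc : IsArc P a c) : b = c := by
  obtain ⟨hab, X, hX, haX, hbX, hX'⟩ := hb
  obtain ⟨hac, Y, hY, haY, hcY, hY'⟩ := hc
  obtain rfl := P.eq_of_mem_parts hX hY haX haY
  have := hX' c hcY
  have := hY' b hbX
  omega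

lemma IsArc.left_unique_s14 {a b c : ℕ} (ha : IsArc P a c) (hb : IsArc P b c) : a = b := by
  obtain ⟨hac, X, hX, haX, hcX, hX'⟩ := ha
  obtain ⟨hbc, Y, hY, hbY, hcY, hY'⟩ := hb
  obtain rfl := P.eq_of_mem_parts hX hY hcX hcY
  have := hX' b hbY
  have := hY' a haX
  omega

lemma IsRed.not_between {a b c : ℕ} (ha : IsRed P a) (hc : IsRed P c) (hab : IsArc P a b) :
    ¬ (a < c ∧ c < b) := by
  obtain ⟨-, X, hX, haX, -, hX'⟩ := hab
  obtain ⟨Y, hY, h0Y, haY⟩ := ha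
  obtain ⟨Z, hZ, h0Z, hcZ⟩ := hc
  obtain rfl := P.eq_of_mem_parts hX hY haX haY
  obtain rfl := P.eq_of_mem_parts hX hZ h0Y h0Z
  exact hX' c hcZ

end Arcs

/-- cyclic rotation creates no black `k`-crossing.
Let `k ≥ 2` and let `P̃` be a partition of `{0,1,…,n}` whose colored arc diagram has no
black `k`-crossing and no red node under a black `(k-1)`-crossing. Let `(i,j)` be the
rightmost red arc belonging to some `k`-crossing, and let `γ = ((i₁,j₁),…,(i_k,j_k))` be
the `k`-crossing with `(i_p,j_p) = (i,j)` for some position `p ≥ 2` which is greatest in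
the lexicographic order of `(j₁,…,j_k)`. Then the arc set obtained by replacing the arcs
`(i₁,j₁),…,(i_p,j_p)` with `(i₁,j₂),(i₂,j₃),…,(i_{p-1},j_p)` (black) and `(i_p,j₁)`
(red), all other arcs keeping their colors, contains no `k` black arcs forming a
`k`-crossing. -/
theorem stmt14 (n k : ℕ) (hk : 2 ≤ k) (P : Finpartition (Finset.range (n + 1)))
    (hP : ¬ SetHasKCrossing (BlackArcSet P) k)
    (hnored : ¬ ∃ a : ℕ, IsRed P a ∧
      ∃ β : Fin (k - 1) → ℕ × ℕ, (∀ m, β m ∈ BlackArcSet P) ∧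
        (StrictMono fun m => (β m).1) ∧ (StrictMono fun m => (β m).2) ∧
        (∀ u v : Fin (k - 1), (β u).1 < (β v).2) ∧
        ∀ m, (β m).1 < a ∧ a < (β m).2)
    (i j : ℕ) (hred : IsRedArc P i j) (hin : InSomeKCrossing P k (i, j))
    (hrightmost : ∀ i' j' : ℕ, IsRedArc P i' j' → InSomeKCrossing P k (i', j') → i' ≤ i)
    (γ : Fin k → ℕ × ℕ) (p : Fin k) (hp : 1 ≤ (p : ℕ))
    (hγmem : ∀ m, γ m ∈ ArcSet P)
    (hγ1 : StrictMono fun m => (γ m).1)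
    (hγ2 : StrictMono fun m => (γ m).2)
    (hγcross : ∀ u v : Fin k, (γ u).1 < (γ v).2)
    (hγp : γ p = (i, j))
    (hgreatest : ∀ δ : Fin k → ℕ × ℕ,
      (∀ m, δ m ∈ ArcSet P) →
      (StrictMono fun m => (δ m).1) →
      (StrictMono fun m => (δ m).2) →
      (∀ u v : Fin k, (δ u).1 < (δ v).2) →
      (∃ q : Fin k, 1 ≤ (q : ℕ) ∧ δ q = (i, j)) →
      ¬ LexLt (fun m => (γ m).2) (fun m => (δ m).2)) :
    ¬ SetHasKCrossing
      ((BlackArcSet P \ {q | ∃ m : Fin k, m ≤ p ∧ q = γ m}) ∪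
        {q | ∃ m m' : Fin k, (m : ℕ) + 1 = (m' : ℕ) ∧ m' ≤ p ∧
          q = ((γ m).1, (γ m').2)}) k := by
  have hG : ∀ a (ha : a < k), (fun a => if h : a < k then γ ⟨a, h⟩ else 0) a = γ ⟨a, ha⟩ :=
    fun a ha => dif_pos ha
  set G : ℕ → ℕ × ℕ := fun a => if h : a < k then γ ⟨a, h⟩ else 0
  have hGseq : IsCrossingSeq k G := by
    refine ⟨fun a b hab hb => ?_, fun a b ha hb => ?_⟩
    · rw [hG a (hab.trans hb), hG b hb]
      exact ⟨hγ1 (Fin.mk_lt_mk.2 hab), hγ2 (Fin.mk_lt_mk.2 hab)⟩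
    · rw [hG a ha, hG b hb]
      exact hγcross _ _
  have hGp : G p = (i, j) := (hG p p.2).trans hγp
  have hij : i < j := by simpa [hγp] using hγcross p p
  have hmain : IsGreatestCrossing (ArcSet P) (BlackArcSet P) k p G := by
    refine ⟨hp, p.2, hGseq, fun x hx => hx.1, fun a ha => hG a ha ▸ hγmem _, ?_, ?_, ?_, ?_, ?_⟩
    · intro a ha hap
      refine ⟨hG a ha ▸ hγmem _, fun hr => ?_⟩
      have harc := IsDiagArc.isArc (P := P) (hG a ha ▸ hγmem ⟨a, ha⟩ : G a ∈ ArcSet P)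
        (hGseq.2 a a ha ha)
      have h1 := hGseq.2 a p ha p.2
      have h2 := hGseq.2 p a p.2 ha
      rw [hGp] at h1 h2
      rcases lt_or_gt_of_ne hap with hlt | hlt
      · have h3 := (hGseq.1 a p hlt p.2).1
        rw [hGp] at h3
        exact hr.1.not_between hred.2.1 harc ⟨h3, h2⟩
      · have h3 := (hGseq.1 p a hlt ha).1
        rw [hGp] at h3
        exact hred.2.1.not_between hr.1 (hred.1.isArc hij) ⟨h3, h1⟩
    · rintro ⟨a, b⟩ hx ⟨c, d⟩ hy hab hcd rfl
      exact Prod.ext rfl ((IsDiagArc.isArc hx hab).right_unique_s14 (IsDiagArc.isArc hy hcd))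
    · rintro ⟨a, b⟩ hx ⟨c, d⟩ hy hab hcd rfl
      exact Prod.ext ((IsDiagArc.isArc hx hab).left_unique_s14 (IsDiagArc.isArc hy hcd)) rfl
    · intro F hF hB
      exact hP ⟨fun m => F m, fun m => hB m m.2, fun a b hab => (hF.1 a b hab b.2).1,
        fun a b hab => (hF.1 a b hab b.2).2, fun a b => hF.2 a b a.2 b.2⟩
    · rintro F hF hA ⟨q, hq1, hqk, hq⟩ ⟨c, hck, hc1, hc2⟩
      refine hgreatest (fun m => F m) (fun m => hA m m.2) (fun a b hab => (hF.1 a b hab b.2).1)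
        (fun a b hab => (hF.1 a b hab b.2).2) (fun a b => hF.2 a b a.2 b.2)
        ⟨⟨q, hqk⟩, hq1, hq.trans hGp⟩ ⟨⟨c, hck⟩, fun a ha => ?_, ?_⟩
      · have := hc1 a ha
        rw [hG a a.2] at this
        exact this.symm
      · rw [hG c hck] at hc2
        exact hc2
  rintro ⟨δ, hδmem, hδ1, hδ2, hδcross⟩
  have hD : ∀ a (ha : a < k), (fun a => if h : a < k then δ ⟨a, h⟩ else 0) a = δ ⟨a, ha⟩ :=
    fun a ha => dif_pos ha
  set D : ℕ → ℕ × ℕ := fun a => if h : a < k then δ ⟨a, h⟩ else 0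
  have hDseq : IsCrossingSeq k D := by
    refine ⟨fun a b hab hb => ?_, fun a b ha hb => ?_⟩
    · rw [hD a (hab.trans hb), hD b hb]
      exact ⟨hδ1 (Fin.mk_lt_mk.2 hab), hδ2 (Fin.mk_lt_mk.2 hab)⟩
    · rw [hD a ha, hD b hb]
      exact hδcross _ _
  refine hmain.not_crossing_of_rotation hDseq (fun a ha => ?_) fun hover => ?_
  · rcases hδmem ⟨a, ha⟩ with ⟨hb, hn⟩ | ⟨m, m', hmm, hmp, he⟩
    · refine Or.inl ⟨hD a ha ▸ hb, fun m hm he => hn ⟨⟨m, hm.trans_lt p.2⟩, hm, ?_⟩⟩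
      rw [← hD a ha, he, hG]
    · have hmp' : (m' : ℕ) ≤ p := hmp
      refine Or.inr ⟨m, by omega, ?_⟩
      rw [hD a ha, he, hG m m.2, hmm, hG m' m'.2]
  · rw [hGp] at hover
    have hseq : ∀ m : Fin (k - 1), 1 ≤ (m : ℕ) + 1 ∧ (m : ℕ) + 1 < k := fun m => by omega
    exact hnored ⟨j, hred.2.2, fun m => D (m + 1),
      fun m => (hover _ (hseq m).1 (hseq m).2).1,
      fun a b hab => (hDseq.1 _ _ (Nat.succ_lt_succ hab) (hseq b).2).1,
      fun a b hab => (hDseq.1 _ _ (Nat.succ_lt_succ hab) (hseq b).2).2,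
      fun a b => hDseq.2 _ _ (hseq a).2 (hseq b).2,
      fun m => (hover _ (hseq m).1 (hseq m).2).2⟩
end

section
/- For all integers n ≥ 0 and i ≥ 0, the number of Motzkin paths of length n with exactly i up steps equals C(n, 2i) · C_i, where C_i is the i-th Catalan number. -/
/-- A Motzkin path of length `l.length`, encoded as a list of steps `1` (up), `-1`
(down), `0` (horizontal): it ends at height `0` and never goes below the `x`-axis. -/
def IsMotzkinPath (l : List ℤ) : Prop :=
  (∀ x ∈ l, x = 1 ∨ x = -1 ∨ x = 0) ∧ l.sum = 0 ∧ ∀ t : ℕ, 0 ≤ (l.take t).sum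

/-- Steps of a lattice path that starts at height `h`, ends at height `0` and never goes below the
`x`-axis. -/
def IsMotzkinPathFrom (h : ℕ) (l : List ℤ) : Prop :=
  (∀ x ∈ l, x = 1 ∨ x = -1 ∨ x = 0) ∧ h + l.sum = 0 ∧ ∀ t : ℕ, 0 ≤ h + (l.take t).sum

theorem isMotzkinPathFrom_zero (l : List ℤ) : IsMotzkinPathFrom 0 l ↔ IsMotzkinPath l := by
  simp [IsMotzkinPathFrom, IsMotzkinPath]

theorem isMotzkinPathFrom_cons (h : ℕ) (a : ℤ) (l : List ℤ) :
    IsMotzkinPathFrom h (a :: l) ↔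
      a = 0 ∧ IsMotzkinPathFrom h l ∨ a = 1 ∧ IsMotzkinPathFrom (h + 1) l ∨
        a = -1 ∧ 0 < h ∧ IsMotzkinPathFrom (h - 1) l := by
  have forall_take (p : ℤ → Prop) : (∀ t : ℕ, p ((a :: l).take t).sum) ↔
      p 0 ∧ ∀ t : ℕ, p (a + (l.take t).sum) :=
    ⟨fun H => ⟨by simpa using H 0, fun t => by simpa using H (t + 1)⟩,
      fun H t => by cases t with
        | zero => simpa using H.1
        | succ t => simpa using H.2 t⟩
  unfold IsMotzkinPathFrom
  rw [forall_take (fun s => 0 ≤ (h : ℤ) + s)]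
  simp only [List.forall_mem_cons, List.sum_cons, ← add_assoc]
  constructor
  · rintro ⟨⟨rfl | rfl | rfl, hl⟩, hs, -, ht⟩
    · exact Or.inr (Or.inl ⟨rfl, hl, by push_cast; exact hs, by push_cast; exact ht⟩)
    · have hpos : 0 < h := by
        have := ht 0
        simp at this
        omega
      have hcast : ((h - 1 : ℕ) : ℤ) = h + -1 := by omega
      exact Or.inr (Or.inr ⟨rfl, hpos, hl, by rwa [hcast], by rwa [hcast]⟩)
    · exact Or.inl ⟨rfl, hl, by simpa using hs, by simpa using ht⟩
  · rintro (⟨rfl, hl, hs, ht⟩ | ⟨rfl, hl, hs, ht⟩ | ⟨rfl, hpos, hl, hs, ht⟩)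
    · exact ⟨⟨by simp, hl⟩, by simpa using hs, by simp, by simpa using ht⟩
    · push_cast at hs ht
      exact ⟨⟨by simp, hl⟩, hs, by simp, ht⟩
    · have hcast : ((h - 1 : ℕ) : ℤ) = h + -1 := by omega
      rw [hcast] at hs
      simp only [hcast] at ht
      exact ⟨⟨by simp, hl⟩, hs, by simp, ht⟩

/-- The paths of length `n` from height `h` to height `0` with `u` up steps, generated by their
first step. -/
def motzkinPathsFrom : ℕ → ℕ → ℕ → Finset (List ℤ)
  | 0, h, u => if h = 0 ∧ u = 0 then {[]} else ∅
  | n + 1, h, u =>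
    (motzkinPathsFrom n h u).image (List.cons 0) ∪
      ((if 0 < u then (motzkinPathsFrom n (h + 1) (u - 1)).image (List.cons 1) else ∅) ∪
        if 0 < h then (motzkinPathsFrom n (h - 1) u).image (List.cons (-1)) else ∅)

theorem mem_motzkinPathsFrom (n h u : ℕ) (l : List ℤ) :
    l ∈ motzkinPathsFrom n h u ↔ l.length = n ∧ IsMotzkinPathFrom h l ∧ l.count 1 = u := by
  induction n generalizing h u l with
  | zero =>
    rw [motzkinPathsFrom, List.length_eq_zero_iff]
    split_ifs with hu
    · obtain ⟨rfl, rfl⟩ := hu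
      simp only [Finset.mem_singleton]
      refine ⟨?_, And.left⟩
      rintro rfl
      simp [IsMotzkinPathFrom]
    · simp only [Finset.notMem_empty, false_iff]
      rintro ⟨rfl, ⟨-, hs, -⟩, hc⟩
      simp at hs hc
      omega
  | succ n ih =>
    cases l with
    | nil =>
      rw [motzkinPathsFrom]
      split_ifs <;> simp
    | cons a l =>
      rw [isMotzkinPathFrom_cons, motzkinPathsFrom, List.count_cons]
      split_ifs with hu hh hh <;>
        simp only [Finset.mem_union, Finset.mem_image, List.cons.injEq, ih, Finset.notMem_empty,
          List.length_cons] <;> grind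

/-- The ballot numbers: paths from height `h` to height `0` with `u` up steps and `u + h` down
steps that never go below the `x`-axis. -/
def ballotNumber : ℕ → ℕ → ℕ
  | 0, _ => 1
  | u + 1, 0 => ballotNumber u 1
  | u + 1, h + 1 => ballotNumber u (h + 2) + ballotNumber (u + 1) h

theorem ballotNumber_succ_add_choose (u h : ℕ) :
    ballotNumber (u + 1) h + (2 * u + 2 + h).choose u = (2 * u + 2 + h).choose (u + 1) := by
  induction u generalizing h with
  | zero =>
    induction h with
    | zero => simp [ballotNumber]
    | succ h ih => simp [ballotNumber] at ih ⊢; omega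
  | succ u ihu =>
    induction h with
    | zero =>
      have h1 := ihu 1
      have h2 := Nat.choose_succ_succ' (2 * u + 3) u
      have h3 := Nat.choose_succ_succ' (2 * u + 3) (u + 1)
      have h4 := Nat.choose_symm_half (u + 1)
      rw [ballotNumber]
      simp only [show 2 * (u + 1) + 2 = 2 * u + 3 + 1 by ring, add_zero,
        show 2 * u + 2 + 1 = 2 * u + 3 by ring, show 2 * (u + 1) + 1 = 2 * u + 3 by ring,
        show u + 1 + 1 = u + 2 by ring] at *
      omega
    | succ h ihh =>
      have h1 := ihu (h + 2)
      have h2 := Nat.choose_succ_succ' (2 * u + 4 + h) u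
      have h3 := Nat.choose_succ_succ' (2 * u + 4 + h) (u + 1)
      rw [ballotNumber]
      simp only [show 2 * (u + 1) + 2 + (h + 1) = 2 * u + 4 + h + 1 by ring,
        show 2 * (u + 1) + 2 + h = 2 * u + 4 + h by ring,
        show 2 * u + 2 + (h + 2) = 2 * u + 4 + h by ring] at *
      omega

theorem ballotNumber_zero_right (u : ℕ) : ballotNumber u 0 = catalan u := by
  cases u with
  | zero => simp [ballotNumber]
  | succ u =>
    have h1 := ballotNumber_succ_add_choose u 0
    have h2 := succ_mul_catalan_eq_centralBinom (u + 1)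
    have h3 := Nat.choose_succ_right_eq (2 * u + 2) u
    rw [Nat.centralBinom, mul_add_one] at h2
    rw [show 2 * u + 2 - u = u + 2 by omega] at h3
    simp only [add_zero] at h1
    nlinarith

theorem card_motzkinPathsFrom (n h u : ℕ) :
    (motzkinPathsFrom n h u).card = n.choose (2 * u + h) * ballotNumber u h := by
  induction n generalizing h u with
  | zero =>
    rw [motzkinPathsFrom]
    split_ifs with hu
    · obtain ⟨rfl, rfl⟩ := hu
      simp [ballotNumber]
    · rw [Nat.choose_eq_zero_of_lt (by omega)]
      simp
  | succ n ih =>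
    rw [motzkinPathsFrom, Finset.card_union_of_disjoint, Finset.card_union_of_disjoint]
    · rcases u with _ | u <;> rcases h with _ | h <;>
        simp [Finset.card_image_of_injective _ List.cons_injective, ih, ballotNumber, mul_add,
          Nat.choose_succ_succ', ← add_assoc]
      · ring
      · ring
      · rw [show 2 * u + h + 1 + 1 = 2 * u + 2 + h by ring, show h + 1 + 1 = h + 2 from rfl]
        ring
    · rw [Finset.disjoint_left]
      split_ifs <;> simp +contextual
    · rw [Finset.disjoint_left]
      split_ifs <;> simp +contextual

/-- For all `n, i ≥ 0`, the number of Motzkin paths of length `n` with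
exactly `i` up steps equals `C(n,2i) ⬝ Catalan(i)`. -/
theorem stmt18 (n i : ℕ) :
    Nat.card {l : List ℤ // l.length = n ∧ IsMotzkinPath l ∧ l.count 1 = i} =
      n.choose (2 * i) * catalan i := by
  rw [Nat.subtype_card (motzkinPathsFrom n 0 i) fun l => by
    rw [mem_motzkinPathsFrom, isMotzkinPathFrom_zero], card_motzkinPathsFrom,
    ballotNumber_zero_right, add_zero]
end
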